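/- There is an absolute constant C > 0 such that for every fixed integer r ≥ 1, with probability tending to 1 as n → ∞ over G ← G(n,1/2), the following hold simultaneously: (a) there exists a feasible solution of the r-round SOS relaxation of maximum clique on G of value at least n^{1/(2r)}/(C^r (log n)^{1/r}), i.e., a positive semidefinite real matrix M with rows and columns indexed by the subsets S ⊆ [n] with |S| ≤ r such that M(S₁,S₂) = M(S₃,S₄) whenever S₁∪S₂ = S₃∪S₄, M({i},{j}) = 0 for every pair {i,j} that is not an edge of G, 0 ≤ M(S₁,S₂) ≤ 1 for all S₁,S₂, M(∅,∅) = 1, and Σ_{i∈[n]} M({i},{i}) ≥ n^{1/(2r)}/(C^r (log n)^{1/r}); and (b) every clique of G has size at most 3·log₂ n. Consequently, the integrality gap of the r-round SOS relaxation of maximum clique on G is at least n^{1/(2r)}/(C^r (log n)²). -/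

import Mathlib

open Finset Filter

/-- Feasibility of a matrix `M`, indexed by the subsets of `[n]` of size at most `r`,
for the `r`-round SOS relaxation of maximum clique on a graph `G` on `[n]`:
`M` is PSD, `M(S₁,S₂)` depends only on `S₁ ∪ S₂`, `M({i},{j}) = 0` for non-edges `{i,j}`,
all entries lie in `[0,1]`, and `M(∅,∅) = 1`. -/
def SOSFeasible (n r : ℕ) (G : SimpleGraph (Fin n))
    (M : Matrix {S : Finset (Fin n) // S.card ≤ r} {S : Finset (Fin n) // S.card ≤ r} ℝ) :
    Prop :=
  M.PosSemidef ∧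
  (∀ S₁ S₂ S₃ S₄ : {S : Finset (Fin n) // S.card ≤ r},
      S₁.1 ∪ S₂.1 = S₃.1 ∪ S₄.1 → M S₁ S₂ = M S₃ S₄) ∧
  (∀ (i j : Fin n) (hi : ({i} : Finset (Fin n)).card ≤ r)
      (hj : ({j} : Finset (Fin n)).card ≤ r),
      i ≠ j → ¬ G.Adj i j → M ⟨{i}, hi⟩ ⟨{j}, hj⟩ = 0) ∧
  (∀ S₁ S₂ : {S : Finset (Fin n) // S.card ≤ r}, 0 ≤ M S₁ S₂ ∧ M S₁ S₂ ≤ 1) ∧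
  (∀ h : (∅ : Finset (Fin n)).card ≤ r, M ⟨∅, h⟩ ⟨∅, h⟩ = 1)

/-- The value `Σ_{i ∈ [n]} M({i},{i})` of a candidate SOS solution (for `r ≥ 1`). -/
noncomputable def SOSValue (n r : ℕ) (hr : 1 ≤ r)
    (M : Matrix {S : Finset (Fin n) // S.card ≤ r} {S : Finset (Fin n) // S.card ≤ r} ℝ) :
    ℝ :=
  ∑ i : Fin n, M ⟨{i}, by simpa using hr⟩ ⟨{i}, by simpa using hr⟩

/-- The bilinear form with kernel `A` is bounded by `N` times the product of the `ℓ²` norms. -/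
def BilinBound {V : Type*} [Fintype V] (A : V → V → ℝ) (N : ℝ) : Prop :=
  ∀ φ ψ : V → ℝ, |∑ x, ∑ y, φ x * ψ y * A x y| ≤ N * √(∑ x, φ x ^ 2) * √(∑ y, ψ y ^ 2)

lemma sum_sq_le_mul_harmonic {V : Type*} [DecidableEq V] (l : V → ℝ) {K : ℝ} (X : Finset V)
    (h : ∀ Y ⊆ X, ∑ x ∈ Y, |l x| ≤ K * √(#Y : ℝ)) :
    ∑ x ∈ X, l x ^ 2 ≤ K ^ 2 * (harmonic #X : ℝ) := by
  induction hm : #X generalizing X with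
  | zero => simp [card_eq_zero.mp hm]
  | succ m ih =>
    have hne : X.Nonempty := card_pos.mp (by omega)
    obtain ⟨x, hx, hmin⟩ := X.exists_min_image (fun x => |l x|) hne
    have h1 : ((m + 1 : ℕ) : ℝ) * |l x| ≤ K * √((m + 1 : ℕ) : ℝ) := by
      have := card_nsmul_le_sum X (fun x => |l x|) (|l x|) hmin
      rw [hm, nsmul_eq_mul] at this
      exact this.trans (hm ▸ h X subset_rfl)
    have hm0 : (0 : ℝ) < ((m + 1 : ℕ) : ℝ) := by positivity
    have h2 : l x ^ 2 ≤ K ^ 2 * ((m + 1 : ℕ) : ℝ)⁻¹ := by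
      have h3 := pow_le_pow_left₀ (by positivity) h1 2
      rw [mul_pow, mul_pow, sq_abs, Real.sq_sqrt hm0.le] at h3
      rw [← div_eq_mul_inv, le_div_iff₀ hm0]
      refine le_of_mul_le_mul_right ?_ hm0
      linarith
    have h4 := ih (X.erase x) (fun Y hY => h Y (hY.trans (erase_subset _ _)))
      (by rw [card_erase_of_mem hx, hm]; rfl)
    rw [← add_sum_erase X _ hx, harmonic_succ]
    push_cast at h2 ⊢
    linarith

lemma sum_sq_le_of_discrepancy {V : Type*} [Fintype V] (l : V → ℝ) {K : ℝ}
    (h : ∀ X : Finset V, |∑ x ∈ X, l x| ≤ K * √(#X : ℝ)) :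
    ∑ x, l x ^ 2 ≤ (2 * K) ^ 2 * (1 + Real.log (Fintype.card V)) := by
  classical
  have hK : 0 ≤ K ∨ IsEmpty V := by
    rcases isEmpty_or_nonempty V with hV | ⟨⟨v⟩⟩
    · exact Or.inr hV
    · left
      have := (abs_nonneg _).trans (h {v})
      simpa using this
  rcases hK with hK | hV
  swap
  · simp; positivity
  have h1 := sum_sq_le_mul_harmonic l (K := 2 * K) univ (fun Y _ => by
    rw [← sum_filter_add_sum_filter_not Y (fun x => 0 ≤ l x)]
    have a1 : ∑ x ∈ Y with 0 ≤ l x, |l x| = ∑ x ∈ Y with 0 ≤ l x, l x :=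
      sum_congr rfl fun x hx => abs_of_nonneg (mem_filter.mp hx).2
    have a2 : ∑ x ∈ Y with ¬ 0 ≤ l x, |l x| = - ∑ x ∈ Y with ¬ 0 ≤ l x, l x := by
      rw [← sum_neg_distrib]
      exact sum_congr rfl fun x hx => abs_of_neg (not_le.mp (mem_filter.mp hx).2)
    have b : ∀ p : V → Prop, ∀ [DecidablePred p], K * √(#(Y.filter p) : ℝ) ≤ K * √(#Y : ℝ) := by
      intro p _
      gcongr
      exact filter_subset _ _
    rw [a1, a2]
    linarith [(le_abs_self _).trans (h (Y.filter (fun x => 0 ≤ l x))),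
      (neg_le_abs _).trans (h (Y.filter (fun x => ¬ 0 ≤ l x))), b (fun x => 0 ≤ l x),
      b (fun x => ¬ 0 ≤ l x)])
  refine h1.trans ?_
  rw [card_univ]
  gcongr
  exact harmonic_le_one_add_log _

lemma bilinBound_of_discrepancy {V : Type*} [Fintype V] (A : V → V → ℝ) {K : ℝ}
    (h : ∀ X Y : Finset V, |∑ x ∈ X, ∑ y ∈ Y, A x y| ≤ K * √(#X : ℝ) * √(#Y : ℝ)) :
    BilinBound A (4 * K * (1 + Real.log (Fintype.card V))) := by
  classical
  intro φ ψ
  have hlog : 0 ≤ 1 + Real.log (Fintype.card V) := by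
    have := Real.log_natCast_nonneg (Fintype.card V)
    linarith
  rcases isEmpty_or_nonempty V with hV | ⟨⟨v⟩⟩
  · simp
  have hK : 0 ≤ K := by simpa using (abs_nonneg _).trans (h {v} {v})
  set H := 1 + Real.log (Fintype.card V)
  have cs : ∀ u w : V → ℝ, |∑ x, u x * w x| ≤ √(∑ x, u x ^ 2) * √(∑ x, w x ^ 2) := by
    intro u w
    rw [← Real.sqrt_mul (by positivity)]
    exact Real.abs_le_sqrt (sum_mul_sq_le_sq_mul_sq _ _ _)
  have key : ∀ (l : V → ℝ) (L : ℝ), 0 ≤ L → (∀ X : Finset V, |∑ x ∈ X, l x| ≤ L * √(#X : ℝ)) →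
      ∀ u : V → ℝ, |∑ x, u x * l x| ≤ 2 * L * √H * √(∑ x, u x ^ 2) := by
    intro l L hL hl u
    refine (cs u l).trans ?_
    rw [mul_comm]
    gcongr
    refine (Real.sqrt_le_sqrt (sum_sq_le_of_discrepancy l hl)).trans ?_
    rw [Real.sqrt_mul (by positivity), Real.sqrt_sq (by positivity)]
  have s1 : ∀ Y : Finset V, |∑ y ∈ Y, ∑ x, φ x * A x y| ≤
      (2 * K * √H * √(∑ x, φ x ^ 2)) * √(#Y : ℝ) := by
    intro Y
    have := key (fun x => ∑ y ∈ Y, A x y) (K * √(#Y : ℝ)) (by positivity)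
      (fun X => (h X Y).trans_eq (by ring)) φ
    rw [sum_comm]
    simp only [mul_sum] at this
    refine this.trans_eq (by ring)
  have s2 := key (fun y => ∑ x, φ x * A x y) _ (by positivity) s1 ψ
  rw [sum_comm]
  have e : ∀ y x, φ x * ψ y * A x y = ψ y * (φ x * A x y) := fun _ _ => by ring
  simp only [e, ← mul_sum]
  refine s2.trans_eq ?_
  have : √H * √H = H := Real.mul_self_sqrt hlog
  linear_combination (4 * K * √(∑ x, φ x ^ 2) * √(∑ y, ψ y ^ 2)) * this

lemma abs_prod_le_one {ι : Type*} (s : Finset ι) (f : ι → ℝ) (hf : ∀ i, |f i| ≤ 1) :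
    |∏ i ∈ s, f i| ≤ 1 := by
  rw [abs_prod]
  exact prod_le_one (fun i _ => abs_nonneg _) (fun i _ => hf i)

lemma sum_sqrt_le {ι : Type*} [Fintype ι] (f : ι → ℝ) (hf : ∀ i, 0 ≤ f i) :
    ∑ i, √(f i) ≤ √(Fintype.card ι : ℝ) * √(∑ i, f i) := by
  simpa using Real.sum_sqrt_mul_sqrt_le (f := fun _ => 1) (g := f) univ
    (fun _ => zero_le_one) hf

lemma abs_sum_prod_le {V I J : Type*} [Fintype V] [DecidableEq I] [DecidableEq J]
    [Fintype I] [Fintype J] (h : I → J → V → V → ℝ) (i₀ : I) (j₀ : J) {N : ℝ} (hN : 0 ≤ N)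
    (h1 : ∀ i j x y, |h i j x y| ≤ 1) (h0 : BilinBound (h i₀ j₀) N)
    (φ : (I → V) → ℝ) (ψ : (J → V) → ℝ) :
    |∑ x, ∑ y, φ x * ψ y * ∏ i, ∏ j, h i j (x i) (y j)| ≤
      N * √((Fintype.card V : ℝ) ^ (Fintype.card I - 1)) *
        √((Fintype.card V : ℝ) ^ (Fintype.card J - 1)) *
        √(∑ x, φ x ^ 2) * √(∑ y, ψ y ^ 2) := by
  let eI := (Equiv.funSplitAt i₀ V).symm
  let eJ := (Equiv.funSplitAt j₀ V).symm
  have sq_le : ∀ a b : ℝ, |b| ≤ 1 → (a * b) ^ 2 ≤ a ^ 2 := by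
    intro a b hb
    rw [mul_pow]
    exact mul_le_of_le_one_right (sq_nonneg _) ((sq_le_one_iff_abs_le_one _).mpr hb)
  have slice : ∀ (x' : {i // i ≠ i₀} → V) (y' : {j // j ≠ j₀} → V),
      |∑ v, ∑ u, φ (eI (v, x')) * ψ (eJ (u, y')) *
        ∏ i, ∏ j, h i j (eI (v, x') i) (eJ (u, y') j)| ≤
      N * (√(∑ v, φ (eI (v, x')) ^ 2) * √(∑ u, ψ (eJ (u, y')) ^ 2)) := by
    intro x' y'
    have eI0 : ∀ v, eI (v, x') i₀ = v := fun v => by simp [eI, Equiv.funSplitAt]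
    have eJ0 : ∀ v, eJ (v, y') j₀ = v := fun v => by simp [eJ, Equiv.funSplitAt]
    have eI1 : ∀ v (i : {i // i ≠ i₀}), eI (v, x') i = x' i := fun v i => by
      simp [eI, Equiv.funSplitAt, i.2]
    have eJ1 : ∀ v (j : {j // j ≠ j₀}), eJ (v, y') j = y' j := fun v j => by
      simp [eJ, Equiv.funSplitAt, j.2]
    let α : V → ℝ := fun v => ∏ j : {j // j ≠ j₀}, h i₀ j v (y' j)
    let β : V → ℝ := fun u => (∏ i : {i // i ≠ i₀}, h i j₀ (x' i) u) *
      ∏ i : {i // i ≠ i₀}, ∏ j : {j // j ≠ j₀}, h i j (x' i) (y' j)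
    have hα : ∀ v, |α v| ≤ 1 := fun v => abs_prod_le_one _ _ fun j => h1 _ _ _ _
    have hβ : ∀ u, |β u| ≤ 1 := fun u => by
      rw [abs_mul]
      exact mul_le_one₀ (abs_prod_le_one _ _ fun i => h1 _ _ _ _) (abs_nonneg _)
        (abs_prod_le_one _ _ fun i => abs_prod_le_one _ _ fun j => h1 _ _ _ _)
    have e : ∀ v u, φ (eI (v, x')) * ψ (eJ (u, y')) *
        ∏ i, ∏ j, h i j (eI (v, x') i) (eJ (u, y') j) =
        (φ (eI (v, x')) * α v) * (ψ (eJ (u, y')) * β u) * h i₀ j₀ v u := by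
      intro v u
      rw [Fintype.prod_eq_mul_prod_subtype_ne _ i₀]
      simp only [Fintype.prod_eq_mul_prod_subtype_ne _ j₀, eI0, eJ0, eI1, eJ1, prod_mul_distrib]
      simp only [α, β]
      ring
    simp only [e]
    refine (h0 _ _).trans ?_
    rw [mul_assoc]
    refine mul_le_mul_of_nonneg_left (mul_le_mul ?_ ?_ (by positivity) (by positivity)) hN
    · exact Real.sqrt_le_sqrt (sum_le_sum fun v _ => sq_le _ _ (hα v))
    · exact Real.sqrt_le_sqrt (sum_le_sum fun u _ => sq_le _ _ (hβ u))
  have sI : ∀ f : (I → V) → ℝ, ∑ x, f x = ∑ x', ∑ v, f (eI (v, x')) := fun f => by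
    rw [← eI.sum_comp, Fintype.sum_prod_type, sum_comm]
  have sJ : ∀ f : (J → V) → ℝ, ∑ x, f x = ∑ x', ∑ v, f (eJ (v, x')) := fun f => by
    rw [← eJ.sum_comp, Fintype.sum_prod_type, sum_comm]
  have cI : ((Fintype.card ({i // i ≠ i₀} → V) : ℕ) : ℝ) =
      (Fintype.card V : ℝ) ^ (Fintype.card I - 1) := by simp
  have cJ : ((Fintype.card ({j // j ≠ j₀} → V) : ℕ) : ℝ) =
      (Fintype.card V : ℝ) ^ (Fintype.card J - 1) := by simp
  rw [sI (fun x => ∑ y, _), sI (fun x => φ x ^ 2), sJ (fun x => ψ x ^ 2)]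
  simp only [sJ]
  calc |∑ x', ∑ v, ∑ y', ∑ u, φ (eI (v, x')) * ψ (eJ (u, y')) *
        ∏ i, ∏ j, h i j (eI (v, x') i) (eJ (u, y') j)|
      = |∑ x', ∑ y', ∑ v, ∑ u, φ (eI (v, x')) * ψ (eJ (u, y')) *
        ∏ i, ∏ j, h i j (eI (v, x') i) (eJ (u, y') j)| := by
        congr 1
        exact sum_congr rfl fun _ _ => sum_comm
    _ ≤ ∑ x', ∑ y', N * (√(∑ v, φ (eI (v, x')) ^ 2) * √(∑ u, ψ (eJ (u, y')) ^ 2)) := by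
        refine (abs_sum_le_sum_abs _ _).trans (sum_le_sum fun x' _ => ?_)
        exact (abs_sum_le_sum_abs _ _).trans (sum_le_sum fun y' _ => slice x' y')
    _ = N * ((∑ x', √(∑ v, φ (eI (v, x')) ^ 2)) * ∑ y', √(∑ u, ψ (eJ (u, y')) ^ 2)) := by
        rw [sum_mul_sum]
        simp only [mul_sum]
    _ ≤ N * ((√((Fintype.card V : ℝ) ^ (Fintype.card I - 1)) * √(∑ x', ∑ v, φ (eI (v, x')) ^ 2)) *
          (√((Fintype.card V : ℝ) ^ (Fintype.card J - 1)) * √(∑ y', ∑ u, ψ (eJ (u, y')) ^ 2))) := by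
        rw [← cI, ← cJ]
        gcongr
        · exact sum_sqrt_le _ fun _ => by positivity
        · exact sum_sqrt_le _ fun _ => by positivity
    _ = _ := by ring

lemma abs_sum_prod_sub_prod_le {V I J : Type*} [Fintype V] [DecidableEq I] [DecidableEq J]
    [Fintype I] [Fintype J] (E F : V → V → ℝ) {N : ℝ} (hN : 0 ≤ N)
    (hE : ∀ x y, |E x y| ≤ 1) (hF : ∀ x y, |F x y| ≤ 1) (hEF : ∀ x y, |E x y - F x y| ≤ 1)
    (hB : BilinBound (fun x y => E x y - F x y) N)
    (φ : (I → V) → ℝ) (ψ : (J → V) → ℝ) :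
    |∑ x, ∑ y, φ x * ψ y * (∏ i, ∏ j, E (x i) (y j) - ∏ i, ∏ j, F (x i) (y j))| ≤
      Fintype.card I * Fintype.card J * (N * √((Fintype.card V : ℝ) ^ (Fintype.card I - 1)) *
        √((Fintype.card V : ℝ) ^ (Fintype.card J - 1)) *
        √(∑ x, φ x ^ 2) * √(∑ y, ψ y ^ 2)) := by
  set B := N * √((Fintype.card V : ℝ) ^ (Fintype.card I - 1)) *
        √((Fintype.card V : ℝ) ^ (Fintype.card J - 1)) *
        √(∑ x, φ x ^ 2) * √(∑ y, ψ y ^ 2)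
  let k : Finset (I × J) → I → J → V → V → ℝ := fun P i j => if (i, j) ∈ P then E else F
  suffices H : ∀ P : Finset (I × J), |∑ x, ∑ y, φ x * ψ y *
      (∏ i, ∏ j, k P i j (x i) (y j) - ∏ i, ∏ j, F (x i) (y j))| ≤ #P * B by
    have := H univ
    simpa [k] using this
  intro P
  induction P using Finset.induction_on with
  | empty => simp [k]
  | insert p P hp ih =>
    obtain ⟨i₀, j₀⟩ := p
    let d : I → J → V → V → ℝ := fun i j =>
      if i = i₀ ∧ j = j₀ then (fun x y => E x y - F x y) else k P i j
    have step : ∀ (x : I → V) (y : J → V), ∏ i, ∏ j, k (insert (i₀, j₀) P) i j (x i) (y j) =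
        ∏ i, ∏ j, k P i j (x i) (y j) + ∏ i, ∏ j, d i j (x i) (y j) := by
      intro x y
      simp only [← Fintype.prod_prod_type']
      rw [← mul_prod_erase univ _ (mem_univ (i₀, j₀)), ← mul_prod_erase univ _ (mem_univ (i₀, j₀)),
        ← mul_prod_erase univ (fun p : I × J => d _ _ _ _) (mem_univ (i₀, j₀))]
      have c1 : ∀ p ∈ univ.erase (i₀, j₀), k (insert (i₀, j₀) P) p.1 p.2 (x p.1) (y p.2) =
          k P p.1 p.2 (x p.1) (y p.2) := by
        intro p hp
        have : p ≠ (i₀, j₀) := ne_of_mem_erase hp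
        simp [k, this]
      have c2 : ∀ p ∈ univ.erase (i₀, j₀), d p.1 p.2 (x p.1) (y p.2) =
          k P p.1 p.2 (x p.1) (y p.2) := by
        intro p hp
        have : ¬ (p.1 = i₀ ∧ p.2 = j₀) := fun h => ne_of_mem_erase hp (Prod.ext h.1 h.2)
        simp [d, this]
      rw [prod_congr rfl c1, prod_congr rfl c2]
      simp [k, d, hp]
      ring
    have hd := abs_sum_prod_le d i₀ j₀ hN (fun i j x y => by
      by_cases h : i = i₀ ∧ j = j₀
      · simpa [d, h] using hEF x y
      · by_cases h' : (i, j) ∈ P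
        · simpa [d, h, k, h'] using hE x y
        · simpa [d, h, k, h'] using hF x y) (by simpa [d] using hB) φ ψ
    have split : ∑ x, ∑ y, φ x * ψ y * (∏ i, ∏ j, k (insert (i₀, j₀) P) i j (x i) (y j) -
        ∏ i, ∏ j, F (x i) (y j)) = (∑ x, ∑ y, φ x * ψ y *
        (∏ i, ∏ j, k P i j (x i) (y j) - ∏ i, ∏ j, F (x i) (y j))) +
        ∑ x, ∑ y, φ x * ψ y * ∏ i, ∏ j, d i j (x i) (y j) := by
      simp only [← sum_add_distrib]
      refine sum_congr rfl fun x _ => sum_congr rfl fun y _ => ?_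
      rw [step]
      ring
    rw [split, card_insert_of_notMem hp]
    push_cast
    refine (abs_add_le _ _).trans ?_
    linarith

/-- The difference of the products of `E` and of `F` over the pairs in `A × B`. -/
def crossDiff {V : Type*} (E F : V → V → ℝ) (A B : Finset V) : ℝ :=
  ∏ a ∈ A, ∏ b ∈ B, E a b - ∏ a ∈ A, ∏ b ∈ B, F a b

lemma sum_strictMono_image {V : Type*} [Fintype V] [LinearOrder V] (a : ℕ) (f : Finset V → ℝ) :
    ∑ x : Fin a → V with StrictMono x, f (univ.image x) = ∑ A ∈ powersetCard a univ, f A := by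
  refine sum_bij (fun x _ => univ.image x) ?_ ?_ ?_ (fun _ _ => rfl)
  · intro x hx
    rw [mem_powersetCard_univ, card_image_of_injective _ (mem_filter.mp hx).2.injective]
    simp
  · intro x hx y hy hxy
    refine (StrictMono.range_inj (mem_filter.mp hx).2 (mem_filter.mp hy).2).mp ?_
    simpa using congrArg (fun s : Finset V => (s : Set V)) hxy
  · intro A hA
    have h := mem_powersetCard_univ.mp hA
    refine ⟨A.orderEmbOfFin h, ?_, ?_⟩
    · simpa using (A.orderEmbOfFin h).strictMono
    · simp

lemma abs_sum_crossDiff_powersetCard_le {V : Type*} [Fintype V] [LinearOrder V]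
    (E F : V → V → ℝ) {N : ℝ} (hN : 0 ≤ N)
    (hE : ∀ x y, |E x y| ≤ 1) (hF : ∀ x y, |F x y| ≤ 1) (hEF : ∀ x y, |E x y - F x y| ≤ 1)
    (hB : BilinBound (fun x y => E x y - F x y) N) (φ ψ : Finset V → ℝ) (a b : ℕ) :
    |∑ A ∈ powersetCard a univ, ∑ B ∈ powersetCard b univ, φ A * ψ B * crossDiff E F A B| ≤
      a * b * (N * √((Fintype.card V : ℝ) ^ (a - 1)) * √((Fintype.card V : ℝ) ^ (b - 1)) *
        √(∑ A ∈ powersetCard a univ, φ A ^ 2) * √(∑ B ∈ powersetCard b univ, ψ B ^ 2)) := by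
  let φ' : (Fin a → V) → ℝ := fun x => if StrictMono x then φ (univ.image x) else 0
  let ψ' : (Fin b → V) → ℝ := fun x => if StrictMono x then ψ (univ.image x) else 0
  have hφ' : ∑ x, φ' x ^ 2 = ∑ A ∈ powersetCard a univ, φ A ^ 2 := by
    simp [φ', ite_pow, ← sum_filter, sum_strictMono_image a (fun A => φ A ^ 2)]
  have hψ' : ∑ x, ψ' x ^ 2 = ∑ A ∈ powersetCard b univ, ψ A ^ 2 := by
    simp [ψ', ite_pow, ← sum_filter, sum_strictMono_image b (fun A => ψ A ^ 2)]
  have h := abs_sum_prod_sub_prod_le E F hN hE hF hEF hB φ' ψ'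
  rw [hφ', hψ', Fintype.card_fin, Fintype.card_fin] at h
  refine le_of_eq_of_le ?_ h
  congr 1
  rw [← sum_strictMono_image, sum_filter]
  refine sum_congr rfl fun x _ => ?_
  by_cases hx : StrictMono x
  swap
  · simp [φ', hx]
  rw [if_pos hx, ← sum_strictMono_image, sum_filter]
  refine sum_congr rfl fun y _ => ?_
  by_cases hy : StrictMono y
  swap
  · simp [ψ', hy]
  simp [φ', ψ', hx, hy, crossDiff, prod_image hx.injective.injOn, prod_image hy.injective.injOn]

lemma abs_sum_crossDiff_le {V : Type*} [Fintype V] [LinearOrder V] [Nonempty V]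
    (E F : V → V → ℝ) {N : ℝ} (hN : 0 ≤ N)
    (hE : ∀ x y, |E x y| ≤ 1) (hF : ∀ x y, |F x y| ≤ 1) (hEF : ∀ x y, |E x y - F x y| ≤ 1)
    (hB : BilinBound (fun x y => E x y - F x y) N) (r : ℕ) (φ : Finset V → ℝ)
    (hφ : ∀ A, r < #A → φ A = 0) :
    |∑ A, ∑ B, φ A * φ B * (2 ^ (#A * #B) * crossDiff E F A B)| ≤
      2 ^ (r * r) * r * r * (r + 1) * (N / Fintype.card V) *
        ∑ A, (Fintype.card V : ℝ) ^ #A * φ A ^ 2 := by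
  set n : ℝ := (Fintype.card V : ℝ) with hn
  have hn0 : 0 < n := by rw [hn]; exact_mod_cast Fintype.card_pos
  let W : ℕ → ℝ := fun a => ∑ A ∈ powersetCard a univ, n ^ #A * φ A ^ 2
  have hW : ∀ a, W a = n ^ a * ∑ A ∈ powersetCard a univ, φ A ^ 2 := fun a => by
    rw [mul_sum]
    exact sum_congr rfl fun A hA => by rw [mem_powersetCard_univ.mp hA]
  have hW0 : ∀ a, 0 ≤ W a := fun a => by rw [hW]; positivity
  have bysize : ∀ f : Finset V → ℝ, (∀ A, r < #A → f A = 0) →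
      ∑ A, f A = ∑ a ∈ range (r + 1), ∑ A ∈ powersetCard a univ, f A := by
    intro f hf
    have : ∑ A ∈ univ with #A ∈ range (r + 1), f A = ∑ A, f A := by
      refine sum_filter_of_ne fun A _ hA => ?_
      by_contra h
      exact hA (hf A (by simpa using h))
    rw [← this, ← sum_fiberwise_of_maps_to (g := fun A : Finset V => #A) (t := range (r + 1))
      (fun A hA => (mem_filter.mp hA).2)]
    refine sum_congr rfl fun a ha => sum_congr ?_ fun _ _ => rfl
    ext A
    simp only [mem_filter, mem_univ, true_and, mem_powersetCard_univ]
    exact ⟨fun h => h.2, fun h => ⟨h ▸ ha, h⟩⟩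
  have block : ∀ a ∈ range (r + 1), ∀ b ∈ range (r + 1),
      |∑ A ∈ powersetCard a univ, ∑ B ∈ powersetCard b univ,
        φ A * φ B * (2 ^ (#A * #B) * crossDiff E F A B)| ≤
      2 ^ (r * r) * r * r * (N / n) * (√(W a) * √(W b)) := by
    intro a ha b hb
    have ha' : a ≤ r := by simpa [Nat.lt_succ_iff] using ha
    have hb' : b ≤ r := by simpa [Nat.lt_succ_iff] using hb
    have e : ∑ A ∈ powersetCard a univ, ∑ B ∈ powersetCard b univ,
        φ A * φ B * (2 ^ (#A * #B) * crossDiff E F A B) = 2 ^ (a * b) *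
        ∑ A ∈ powersetCard a univ, ∑ B ∈ powersetCard b univ, φ A * φ B * crossDiff E F A B := by
      simp only [mul_sum]
      refine sum_congr rfl fun A hA => sum_congr rfl fun B hB => ?_
      rw [mem_powersetCard_univ.mp hA, mem_powersetCard_univ.mp hB]
      ring
    have h := abs_sum_crossDiff_powersetCard_le E F hN hE hF hEF hB φ φ a b
    rw [e, abs_mul, abs_of_pos (by positivity : (0 : ℝ) < 2 ^ (a * b))]
    have h' : |∑ A ∈ powersetCard a univ, ∑ B ∈ powersetCard b univ,
        φ A * φ B * crossDiff E F A B| ≤ r * r * ((N / n) * (√(W a) * √(W b))) := by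
      refine h.trans ?_
      rcases Nat.eq_zero_or_pos a with rfl | ha0
      · simp only [Nat.cast_zero, zero_mul]
        positivity
      rcases Nat.eq_zero_or_pos b with rfl | hb0
      · simp only [Nat.cast_zero, zero_mul, mul_zero]
        positivity
      have pw : ∀ c : ℕ, 0 < c → √(n ^ (c - 1)) = √(n ^ c) / √n := fun c hc => by
        rw [← Real.sqrt_div (by positivity)]
        congr 1
        rw [eq_div_iff hn0.ne', ← pow_succ, Nat.sub_add_cancel hc]
      have : N * √(n ^ (a - 1)) * √(n ^ (b - 1)) * √(∑ A ∈ powersetCard a univ, φ A ^ 2) *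
          √(∑ B ∈ powersetCard b univ, φ B ^ 2) = (N / n) * (√(W a) * √(W b)) := by
        rw [pw a ha0, pw b hb0, hW, hW, Real.sqrt_mul (by positivity),
          Real.sqrt_mul (by positivity)]
        nth_rewrite 5 [← Real.mul_self_sqrt hn0.le]
        field_simp
      rw [this]
      gcongr
    calc (2 : ℝ) ^ (a * b) * _ ≤ 2 ^ (r * r) * (r * r * ((N / n) * (√(W a) * √(W b)))) := by
          gcongr
          norm_num
      _ = _ := by ring
  have cs : (∑ a ∈ range (r + 1), √(W a)) ^ 2 ≤ (r + 1) * ∑ a ∈ range (r + 1), W a := by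
    have := sq_sum_le_card_mul_sum_sq (s := range (r + 1)) (f := fun a => √(W a))
    simpa [Real.sq_sqrt, hW0] using this
  rw [bysize _ (fun A hA => by simp [hφ A hA]), bysize _ (fun A hA => by simp [hφ A hA])]
  have e : ∀ a, ∑ A ∈ powersetCard a univ, ∑ B,
      φ A * φ B * (2 ^ (#A * #B) * crossDiff E F A B) = ∑ b ∈ range (r + 1),
      ∑ A ∈ powersetCard a univ, ∑ B ∈ powersetCard b univ,
        φ A * φ B * (2 ^ (#A * #B) * crossDiff E F A B) := fun a => by
    refine (sum_congr rfl fun A _ => ?_).trans sum_comm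
    exact bysize (fun B => φ A * φ B * (2 ^ (#A * #B) * crossDiff E F A B))
      (fun B hB => by simp [hφ B hB])
  simp only [e]
  calc _ ≤ ∑ a ∈ range (r + 1), ∑ b ∈ range (r + 1),
        2 ^ (r * r) * r * r * (N / n) * (√(W a) * √(W b)) :=
        (abs_sum_le_sum_abs _ _).trans (sum_le_sum fun a ha =>
          (abs_sum_le_sum_abs _ _).trans (sum_le_sum fun b hb => block a ha b hb))
    _ = 2 ^ (r * r) * r * r * (N / n) * (∑ a ∈ range (r + 1), √(W a)) ^ 2 := by
        rw [sq, sum_mul_sum]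
        simp only [mul_sum]
    _ ≤ 2 ^ (r * r) * r * r * (N / n) * ((r + 1) * ∑ a ∈ range (r + 1), W a) := by gcongr
    _ = _ := by simp only [W]; ring

lemma sum_disjoint_union {V : Type*} [Fintype V] [DecidableEq V] (C : Finset V)
    (f : Finset V → Finset V → ℝ) :
    ∑ A, (if Disjoint C A then f A (C ∪ A) else 0) =
      ∑ S, if C ⊆ S then f (S \ C) S else 0 := by
  rw [← sum_filter, ← sum_filter]
  refine sum_bij' (fun A _ => C ∪ A) (fun S _ => S \ C) ?_ ?_ ?_ ?_ ?_
  · intro A _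
    simp
  · intro S _
    simpa using disjoint_sdiff
  · intro A hA
    exact union_sdiff_cancel_left (mem_filter.mp hA).2
  · intro S hS
    exact union_sdiff_of_subset (mem_filter.mp hS).2
  · intro A hA
    rw [union_sdiff_cancel_left (mem_filter.mp hA).2]

lemma crossDiff_eq_zero {V : Type*} {E F : V → V → ℝ} (hE : ∀ v, E v v = 0)
    (hF : ∀ v, F v v = 0) {A B : Finset V} {v : V} (hA : v ∈ A) (hB : v ∈ B) :
    crossDiff E F A B = 0 := by
  rw [crossDiff, prod_eq_zero hA (prod_eq_zero hB (hE v)),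
    prod_eq_zero hA (prod_eq_zero hB (hF v)), sub_zero]

lemma sum_crossDiff_sdiff {V : Type*} [Fintype V] [DecidableEq V] {E F : V → V → ℝ}
    (hE : ∀ v, E v v = 0) (hF : ∀ v, F v v = 0) (h : ℕ → ℝ) (x : Finset V → ℝ) :
    ∑ S, ∑ T, x S * x T * (h #(S ∩ T) *
        (2 ^ (#(S \ T) * #(T \ S)) * crossDiff E F (S \ T) (T \ S))) =
      ∑ C, h #C * ∑ A, ∑ B, (if Disjoint C A then x (C ∪ A) else 0) *
        (if Disjoint C B then x (C ∪ B) else 0) * (2 ^ (#A * #B) * crossDiff E F A B) := by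
  have e : ∀ C : Finset V, ∑ A, ∑ B, (if Disjoint C A then x (C ∪ A) else 0) *
        (if Disjoint C B then x (C ∪ B) else 0) * (2 ^ (#A * #B) * crossDiff E F A B) =
      ∑ S, ∑ T, if C ⊆ S ∧ C ⊆ T then
        x S * x T * (2 ^ (#(S \ C) * #(T \ C)) * crossDiff E F (S \ C) (T \ C)) else 0 := by
    intro C
    have e1 := sum_disjoint_union C (fun A S => ∑ T, if C ⊆ T then
        x S * x T * (2 ^ (#A * #(T \ C)) * crossDiff E F A (T \ C)) else 0)
    refine Eq.trans (sum_congr rfl fun A _ => ?_) (e1.trans (sum_congr rfl fun S _ => ?_))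
    · by_cases hA : Disjoint C A
      · rw [if_pos hA, ← sum_disjoint_union C (fun B T =>
          x (C ∪ A) * x T * (2 ^ (#A * #B) * crossDiff E F A B))]
        simp [hA]
      · simp [hA]
    · by_cases hS : C ⊆ S <;> simp [hS]
  simp only [e, mul_sum]
  symm
  rw [sum_comm]
  refine sum_congr rfl fun S _ => ?_
  rw [sum_comm]
  refine sum_congr rfl fun T _ => ?_
  rw [sum_eq_single (S ∩ T)]
  · simp only [inter_subset_left, inter_subset_right, and_self, if_true, sdiff_inter_self_left,
      sdiff_inter_self_right]
    ring
  · intro C _ hC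
    by_cases h' : C ⊆ S ∧ C ⊆ T
    · have : ∃ v ∈ S ∩ T, v ∉ C := by
        by_contra! hcon
        exact hC (Subset.antisymm (subset_inter h'.1 h'.2) hcon)
      obtain ⟨v, hv, hvC⟩ := this
      rw [crossDiff_eq_zero hE hF (v := v) (mem_sdiff.mpr ⟨mem_of_mem_inter_left hv, hvC⟩)
        (mem_sdiff.mpr ⟨mem_of_mem_inter_right hv, hvC⟩)]
      simp
    · simp [h']
  · simp

lemma sum_superset_moebius {V : Type*} [Fintype V] [DecidableEq V] (x : Finset V → ℝ)
    (S : Finset V) :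
    x S = ∑ U, if S ⊆ U then (-1) ^ #(U \ S) * ∑ T, (if U ⊆ T then x T else 0) else 0 := by
  rw [← sum_disjoint_union S (fun A U => (-1) ^ #A * ∑ T, (if U ⊆ T then x T else 0))]
  have e : ∀ A, (if Disjoint S A then (-1 : ℝ) ^ #A * ∑ T, (if S ∪ A ⊆ T then x T else 0) else 0) =
      ∑ T, if S ⊆ T ∧ A ⊆ T \ S then (-1) ^ #A * x T else 0 := by
    intro A
    by_cases hA : Disjoint S A
    · simp only [hA, if_true, mul_sum, mul_ite, mul_zero]
      refine sum_congr rfl fun T _ => if_congr ?_ rfl rfl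
      rw [union_subset_iff, subset_sdiff]
      simp [hA.symm]
    · have : ∀ T, ¬ (S ⊆ T ∧ A ⊆ T \ S) := fun T h => hA (subset_sdiff.mp h.2).2.symm
      simp [hA, this]
  simp only [e]
  rw [sum_comm, sum_eq_single S]
  · simp
  · intro T _ hT
    by_cases hST : S ⊆ T
    · have hne : T \ S ≠ ∅ := fun h => hT (Subset.antisymm (sdiff_eq_empty_iff_subset.mp h) hST)
      have h0 := sum_powerset_neg_one_pow_card (x := T \ S)
      rw [if_neg hne] at h0
      have h1 : ∑ A ∈ (T \ S).powerset, (-1 : ℝ) ^ #A = 0 := by exact_mod_cast h0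
      simp only [hST, true_and, ← sum_filter, ← mem_powerset, filter_mem_eq_inter, univ_inter,
        ← sum_mul, h1, zero_mul]
    · simp [hST]
  · simp

lemma sum_sq_le_sum_superset_sq {V : Type*} [Fintype V] [DecidableEq V] [Nonempty V] (r : ℕ)
    (x : Finset V → ℝ) (hx : ∀ S, r < #S → x S = 0) :
    ∑ S, (Fintype.card V : ℝ) ^ #S * x S ^ 2 ≤
      (r + 1) * 2 ^ r * ∑ U, (Fintype.card V : ℝ) ^ #U * (∑ T, if U ⊆ T then x T else 0) ^ 2 := by
  set n : ℝ := (Fintype.card V : ℝ) with hn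
  have hn0 : 0 < n := by rw [hn]; exact_mod_cast Fintype.card_pos
  let y : Finset V → ℝ := fun U => ∑ T, if U ⊆ T then x T else 0
  have hy : ∀ U, r < #U → y U = 0 := fun U hU => sum_eq_zero fun T _ => by
    split_ifs with h
    · exact hx T (hU.trans_le (card_le_card h))
    · rfl
  have count : ∀ S : Finset V, ∑ U, (if S ⊆ U ∧ #U ≤ r then n ^ #S / n ^ #U else 0) ≤ r + 1 := by
    intro S
    have e := sum_disjoint_union S (fun A U => if #U ≤ r then (n ^ #A)⁻¹ else 0)
    have e' : ∑ U, (if S ⊆ U ∧ #U ≤ r then n ^ #S / n ^ #U else 0) =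
        ∑ U, if S ⊆ U then (if #U ≤ r then (n ^ #(U \ S))⁻¹ else 0) else 0 := by
      refine sum_congr rfl fun U _ => ?_
      by_cases h : S ⊆ U
      · by_cases h' : #U ≤ r
        · simp only [h, h', and_self, if_true]
          have : #U = #S + #(U \ S) := by rw [card_sdiff_of_subset h]; have := card_le_card h; omega
          rw [this, pow_add]
          field_simp
        · simp [h']
      · simp [h]
    rw [e', ← e]
    calc _ ≤ ∑ A : Finset V, if #A ≤ r then (n ^ #A)⁻¹ else 0 := by
          refine sum_le_sum fun A _ => ?_
          have hle : #A ≤ #(S ∪ A) := card_le_card subset_union_right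
          by_cases h1 : #A ≤ r
          · rw [if_pos h1]
            split_ifs <;> first | exact le_rfl | positivity
          · have h2 : ¬ #(S ∪ A) ≤ r := by omega
            simp [h1, h2]
      _ = ∑ j ∈ range (Fintype.card V + 1),
          (Fintype.card V).choose j • (if j ≤ r then (n ^ j)⁻¹ else 0) := by
          have := sum_powerset_apply_card (fun j => if j ≤ r then (n ^ j)⁻¹ else 0)
            (x := (univ : Finset V))
          simpa using this
      _ ≤ ∑ j ∈ range (Fintype.card V + 1), (if j ∈ range (r + 1) then 1 else 0) := by
          refine sum_le_sum fun j _ => ?_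
          by_cases hj : j ≤ r
          · simp only [hj, if_true, mem_range, Nat.lt_succ_iff, nsmul_eq_mul]
            rw [← div_eq_mul_inv, div_le_one (by positivity), hn]
            exact_mod_cast Nat.choose_le_pow _ _
          · simp [hj]
      _ ≤ r + 1 := by
          rw [← sum_filter, sum_const, nsmul_one]
          have : #((range (Fintype.card V + 1)).filter (· ∈ range (r + 1))) ≤ #(range (r + 1)) :=
            card_le_card fun j hj => (mem_filter.mp hj).2
          rw [card_range] at this
          exact_mod_cast this
  have pointwise : ∀ S, n ^ #S * x S ^ 2 ≤ (r + 1) * ∑ U, if S ⊆ U then n ^ #U * y U ^ 2 else 0 := by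
    intro S
    have h1 : x S ^ 2 ≤ (∑ U, (if S ⊆ U ∧ #U ≤ r then 1 / n ^ #U else 0)) *
        ∑ U, (if S ⊆ U then n ^ #U * y U ^ 2 else 0) := by
      rw [sum_superset_moebius x S]
      refine sum_sq_le_sum_mul_sum_of_sq_le_mul _ (fun U _ => ?_) (fun U _ => ?_) (fun U _ => ?_)
      · split_ifs <;> positivity
      · split_ifs <;> positivity
      · by_cases hU : S ⊆ U
        · by_cases hr : #U ≤ r
          · simp only [hU, hr, and_self, if_true]
            change ((-1) ^ #(U \ S) * y U) ^ 2 ≤ _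
            rw [mul_pow, ← pow_mul, mul_comm #(U \ S) 2, pow_mul]
            refine le_of_eq ?_
            field_simp
            norm_num
          · have : (∑ T, if U ⊆ T then x T else 0) = 0 := hy U (by omega)
            simp [hr, this]
        · simp [hU]
    calc n ^ #S * x S ^ 2 ≤ n ^ #S * ((∑ U, (if S ⊆ U ∧ #U ≤ r then 1 / n ^ #U else 0)) *
        ∑ U, (if S ⊆ U then n ^ #U * y U ^ 2 else 0)) := by gcongr
      _ = (∑ U, (if S ⊆ U ∧ #U ≤ r then n ^ #S / n ^ #U else 0)) *
        ∑ U, (if S ⊆ U then n ^ #U * y U ^ 2 else 0) := by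
          rw [← mul_assoc]
          congr 1
          rw [mul_sum]
          simp only [mul_ite, mul_zero, mul_one_div]
      _ ≤ _ := by
          refine mul_le_mul_of_nonneg_right (count S) (sum_nonneg fun U _ => ?_)
          split_ifs <;> positivity
  calc _ ≤ ∑ S, ((r : ℝ) + 1) * ∑ U, (if S ⊆ U then n ^ #U * y U ^ 2 else 0) :=
        sum_le_sum fun S _ => pointwise S
    _ = ((r : ℝ) + 1) * ∑ U, 2 ^ #U * (n ^ #U * y U ^ 2) := by
        rw [← mul_sum, sum_comm]
        congr 1
        refine sum_congr rfl fun U _ => ?_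
        rw [← sum_filter, sum_const, nsmul_eq_mul]
        have : (univ.filter fun S => S ⊆ U) = U.powerset := by ext; simp
        rw [this, card_powerset]
        norm_num
    _ ≤ ((r : ℝ) + 1) * ∑ U, 2 ^ r * (n ^ #U * y U ^ 2) := by
        refine mul_le_mul_of_nonneg_left (sum_le_sum fun U _ => ?_) (by positivity)
        by_cases hU : #U ≤ r
        · gcongr
          norm_num
        · simp [hy U (by omega)]
    _ = _ := by
        rw [← mul_sum]
        ring

lemma sum_card_inter_eq {V : Type*} [Fintype V] [DecidableEq V] (r : ℕ) (h w : ℕ → ℝ)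
    (hw : ∀ c ≤ r, h c = ∑ j ∈ range (c + 1), c.choose j * w j) (x : Finset V → ℝ)
    (hx : ∀ S, r < #S → x S = 0) :
    ∑ S, ∑ T, x S * x T * h #(S ∩ T) = ∑ U, w #U * (∑ T, if U ⊆ T then x T else 0) ^ 2 := by
  have e : ∀ S T : Finset V, x S * x T * h #(S ∩ T) =
      ∑ U, w #U * ((if U ⊆ S then x S else 0) * (if U ⊆ T then x T else 0)) := by
    intro S T
    by_cases hS : r < #S
    · simp [hx S hS]
    have hc : #(S ∩ T) ≤ r := (card_le_card inter_subset_left).trans (not_lt.mp hS)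
    have h1 := sum_powerset_apply_card w (x := S ∩ T)
    simp only [nsmul_eq_mul] at h1
    have h2 : (S ∩ T).powerset = univ.filter fun U => U ⊆ S ∧ U ⊆ T := by
      ext U
      rw [mem_powerset, subset_inter_iff]
      simp
    rw [hw _ hc, ← h1, h2, sum_filter, mul_sum]
    refine sum_congr rfl fun U _ => ?_
    by_cases h3 : U ⊆ S <;> by_cases h4 : U ⊆ T <;> simp [h3, h4]
    ring
  simp only [e]
  symm
  calc _ = ∑ U, ∑ S, ∑ T, w #U * ((if U ⊆ S then x S else 0) * (if U ⊆ T then x T else 0)) := by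
        refine sum_congr rfl fun U _ => ?_
        rw [sq, sum_mul_sum]
        simp only [mul_sum]
    _ = _ := by
        rw [sum_comm]
        exact sum_congr rfl fun S _ => sum_comm

lemma quadForm_nonneg {V : Type*} [Fintype V] [LinearOrder V] [Nonempty V]
    (E F : V → V → ℝ) {N : ℝ} (hN : 0 ≤ N)
    (hE : ∀ x y, |E x y| ≤ 1) (hF : ∀ x y, |F x y| ≤ 1) (hEF : ∀ x y, |E x y - F x y| ≤ 1)
    (hB : BilinBound (fun x y => E x y - F x y) N)
    (hE0 : ∀ v, E v v = 0) (hF0 : ∀ v, F v v = 0) (r : ℕ) (h w : ℕ → ℝ)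
    (hh0 : ∀ c, 0 ≤ h c) (hh : ∀ c, h c ≤ (Fintype.card V : ℝ) ^ c)
    (hw : ∀ c ≤ r, h c = ∑ j ∈ range (c + 1), c.choose j * w j)
    (hwN : ∀ j ≤ r, 2 ^ (r * r) * r * r * (r + 1) * (N / Fintype.card V) * 2 ^ r *
      ((r + 1) * 2 ^ r) * (Fintype.card V : ℝ) ^ j ≤ w j)
    (x : Finset V → ℝ) (hx : ∀ S, r < #S → x S = 0) :
    0 ≤ ∑ S, ∑ T, x S * x T * (h #(S ∩ T) *
      (1 + 2 ^ (#(S \ T) * #(T \ S)) * crossDiff E F (S \ T) (T \ S))) := by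
  set n : ℝ := (Fintype.card V : ℝ) with hn
  have hn0 : 0 < n := by rw [hn]; exact_mod_cast Fintype.card_pos
  set κ : ℝ := 2 ^ (r * r) * r * r * (r + 1) * (N / n) with hκ
  have hκ0 : 0 ≤ κ := by positivity
  let y : Finset V → ℝ := fun U => ∑ T, if U ⊆ T then x T else 0
  have hy : ∀ U, r < #U → y U = 0 := fun U hU => sum_eq_zero fun T _ => by
    split_ifs with h
    · exact hx T (hU.trans_le (card_le_card h))
    · rfl
  have split : ∑ S, ∑ T, x S * x T * (h #(S ∩ T) *
      (1 + 2 ^ (#(S \ T) * #(T \ S)) * crossDiff E F (S \ T) (T \ S))) =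
      ∑ U, w #U * y U ^ 2 + ∑ S, ∑ T, x S * x T * (h #(S ∩ T) *
        (2 ^ (#(S \ T) * #(T \ S)) * crossDiff E F (S \ T) (T \ S))) := by
    rw [← sum_card_inter_eq r h w hw x hx]
    simp only [← sum_add_distrib]
    exact sum_congr rfl fun S _ => sum_congr rfl fun T _ => by ring
  have fluct : |∑ S, ∑ T, x S * x T * (h #(S ∩ T) *
        (2 ^ (#(S \ T) * #(T \ S)) * crossDiff E F (S \ T) (T \ S)))| ≤
      κ * (2 ^ r * ∑ S, n ^ #S * x S ^ 2) := by
    rw [sum_crossDiff_sdiff hE0 hF0]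
    calc _ ≤ ∑ C : Finset V, n ^ #C * (κ * ∑ A, n ^ #A *
          (if Disjoint C A then x (C ∪ A) else 0) ^ 2) := by
          refine (abs_sum_le_sum_abs _ _).trans (sum_le_sum fun C _ => ?_)
          rw [abs_mul, abs_of_nonneg (hh0 _)]
          refine mul_le_mul (hh _) ?_ (abs_nonneg _) (by positivity)
          refine abs_sum_crossDiff_le E F hN hE hF hEF hB r
            (fun A => if Disjoint C A then x (C ∪ A) else 0) fun A hA => ?_
          have := hx (C ∪ A) (hA.trans_le (card_le_card subset_union_right))
          simp [this]
      _ = ∑ C : Finset V, κ * ∑ S, if C ⊆ S then n ^ #S * x S ^ 2 else 0 := by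
          refine sum_congr rfl fun C _ => ?_
          rw [mul_left_comm]
          congr 1
          have e := sum_disjoint_union C (fun A S => n ^ #C * (n ^ #A * x S ^ 2))
          rw [mul_sum]
          refine Eq.trans (sum_congr rfl fun A _ => ?_)
            (e.trans (sum_congr rfl fun S _ => ?_))
          · by_cases hA : Disjoint C A <;> simp [hA]
          · by_cases hS : C ⊆ S
            · have : #S = #C + #(S \ C) := by
                rw [card_sdiff_of_subset hS]; have := card_le_card hS; omega
              rw [if_pos hS, if_pos hS, this, pow_add]
              ring
            · simp [hS]
      _ = κ * ∑ S, 2 ^ #S * (n ^ #S * x S ^ 2) := by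
          rw [← mul_sum, sum_comm]
          congr 1
          refine sum_congr rfl fun U _ => ?_
          rw [← sum_filter, sum_const, nsmul_eq_mul]
          have : (univ.filter fun S => S ⊆ U) = U.powerset := by ext; simp
          rw [this, card_powerset]
          norm_num
      _ ≤ κ * ∑ S, 2 ^ r * (n ^ #S * x S ^ 2) := by
          refine mul_le_mul_of_nonneg_left (sum_le_sum fun S _ => ?_) hκ0
          by_cases hS : #S ≤ r
          · gcongr
            norm_num
          · simp [hx S (by omega)]
      _ = _ := by rw [← mul_sum]
  have inv := sum_sq_le_sum_superset_sq r x hx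
  have main : κ * (2 ^ r * ((r + 1) * 2 ^ r * ∑ U, n ^ #U * y U ^ 2)) ≤ ∑ U, w #U * y U ^ 2 := by
    simp only [mul_sum]
    refine sum_le_sum fun U _ => ?_
    by_cases hU : #U ≤ r
    · calc _ = (κ * 2 ^ r * ((r + 1) * 2 ^ r) * n ^ #U) * y U ^ 2 := by ring
        _ ≤ _ := mul_le_mul_of_nonneg_right (hwN _ hU) (sq_nonneg _)
    · simp [hy U (by omega)]
  rw [split]
  have inv' : κ * (2 ^ r * ∑ S, n ^ #S * x S ^ 2) ≤
      κ * (2 ^ r * ((r + 1) * 2 ^ r * ∑ U, n ^ #U * y U ^ 2)) := by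
    gcongr
  linarith [neg_le_of_abs_le fluct]

lemma choose_two_add_add (a b c : ℕ) :
    (a + b + c).choose 2 + c.choose 2 = (a + c).choose 2 + (b + c).choose 2 + a * b := by
  have : (((a + b + c).choose 2 + c.choose 2 : ℕ) : ℚ) =
      ((a + c).choose 2 + (b + c).choose 2 + a * b : ℕ) := by
    push_cast [Nat.cast_choose_two]
    ring
  exact_mod_cast this

lemma choose_two_le_mul_self {s r : ℕ} (h : s ≤ r) : s.choose 2 ≤ r * r := by
  rw [Nat.choose_two_right]
  exact (Nat.div_le_self _ _).trans (Nat.mul_le_mul h ((Nat.sub_le _ _).trans h))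

lemma le_fwdDiff_iter {Q : ℝ} (r : ℕ) (hQ : 2 ^ (r + 1 + r * r) ≤ Q) {j : ℕ} (hj : j ≤ r) :
    Q ^ j / (2 * 2 ^ (r * r)) ≤
      (fwdDiff 1)^[j] (fun c : ℕ => Q ^ c / (2 : ℝ) ^ c.choose 2) 0 := by
  have hQ1 : 1 ≤ Q := (one_le_pow₀ (by norm_num)).trans hQ
  have hQ0 : 0 < Q := by linarith
  have h2 : (2 : ℝ) ^ j.choose 2 ≤ 2 ^ (r * r) :=
    pow_le_pow_right₀ (by norm_num) (choose_two_le_mul_self hj)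
  rw [fwdDiff_iter_eq_sum_shift, sum_range_succ]
  simp only [zsmul_eq_mul, zero_add, smul_eq_mul, mul_one, Nat.sub_self, pow_zero, one_mul,
    Nat.choose_self, Nat.cast_one, Int.cast_one]
  have hmain : Q ^ j / 2 ^ (r * r) ≤ Q ^ j / 2 ^ j.choose 2 := by gcongr
  have hhalf : Q ^ j / (2 * 2 ^ (r * r)) = Q ^ j / 2 ^ (r * r) / 2 := by field_simp
  rcases Nat.eq_zero_or_pos j with rfl | hjpos
  · simp only [range_zero, sum_empty, zero_add]
    rw [hhalf]
    have : 0 < Q ^ 0 / (2 : ℝ) ^ (r * r) := by positivity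
    linarith
  have hrest : |∑ i ∈ range j, (((-1) ^ (j - i) * (j.choose i : ℤ) : ℤ) : ℝ) *
      (Q ^ i / 2 ^ i.choose 2)| ≤ 2 ^ r * Q ^ (j - 1) := by
    calc _ ≤ ∑ i ∈ range j, (j.choose i : ℝ) * Q ^ (j - 1) := by
          refine (abs_sum_le_sum_abs _ _).trans (sum_le_sum fun i hi => ?_)
          have hi' : i ≤ j - 1 := by have := mem_range.mp hi; omega
          push_cast
          rw [abs_mul, abs_mul, abs_pow, abs_neg, abs_one, one_pow, one_mul, Nat.abs_cast,
            abs_of_nonneg (by positivity)]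
          refine mul_le_mul_of_nonneg_left ?_ (by positivity)
          exact (div_le_self (by positivity) (one_le_pow₀ (by norm_num))).trans
            (pow_le_pow_right₀ hQ1 hi')
      _ ≤ (∑ i ∈ range (j + 1), (j.choose i : ℝ)) * Q ^ (j - 1) := by
          rw [← sum_mul]
          refine mul_le_mul_of_nonneg_right ?_ (by positivity)
          exact sum_le_sum_of_subset_of_nonneg (range_mono (Nat.le_succ j))
            fun _ _ _ => by positivity
      _ ≤ _ := by
          have : (∑ i ∈ range (j + 1), (j.choose i : ℝ)) = 2 ^ j := by
            exact_mod_cast Nat.sum_range_choose j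
          rw [this]
          gcongr
          norm_num
  have hle : 2 ^ r * Q ^ (j - 1) ≤ Q ^ j / 2 ^ (r * r) / 2 := by
    have hQj : Q ^ j = Q ^ (j - 1) * Q := by rw [← pow_succ]; congr 1; omega
    rw [hQj, le_div_iff₀ (by norm_num), le_div_iff₀ (by positivity)]
    calc _ = Q ^ (j - 1) * 2 ^ (r + 1 + r * r) := by ring
      _ ≤ _ := by gcongr
  rw [hhalf]
  linarith [neg_le_of_abs_le hrest]

/-- The value given to a clique on `s` vertices by the pseudo-expectation with density `q`. -/
def cliqueWeight (q : ℝ) (s : ℕ) : ℝ := q ^ s * 2 ^ s.choose 2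

lemma cliqueWeight_nonneg {q : ℝ} (hq : 0 ≤ q) (s : ℕ) : 0 ≤ cliqueWeight q s := by
  unfold cliqueWeight
  positivity

lemma cliqueWeight_le_one {q : ℝ} (hq : 0 ≤ q) {r s : ℕ} (hs : s ≤ 2 * r) (h : q * 2 ^ r ≤ 1) :
    cliqueWeight q s ≤ 1 := by
  have h1 : s.choose 2 ≤ r * s := by
    rw [Nat.choose_two_right]
    refine Nat.div_le_of_le_mul ?_
    calc s * (s - 1) ≤ s * (2 * r) := Nat.mul_le_mul_left _ (by omega)
      _ = _ := by ring
  calc cliqueWeight q s ≤ q ^ s * 2 ^ (r * s) := by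
        unfold cliqueWeight
        gcongr
        norm_num
    _ = (q * 2 ^ r) ^ s := by rw [mul_pow, pow_mul]
    _ ≤ 1 := pow_le_one₀ (by positivity) h

open Classical in
/-- The edge indicator of a graph. -/
noncomputable def adjInd {V : Type*} (G : SimpleGraph V) (x y : V) : ℝ :=
  if G.Adj x y then 1 else 0

open Classical in
/-- The edge density of the random graph `G(n,1/2)`, zero on the diagonal. -/
noncomputable def halfInd {V : Type*} (x y : V) : ℝ := if x = y then 0 else 1 / 2

open Classical in
/-- The moment matrix giving weight `cliqueWeight q s` to every clique on `s` vertices. -/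
noncomputable def cliqueMoment {V : Type*} [DecidableEq V] (G : SimpleGraph V) (q : ℝ)
    (S T : Finset V) : ℝ :=
  if G.IsClique (↑(S ∪ T) : Set V) then cliqueWeight q #(S ∪ T) else 0

lemma prod_adjInd {V : Type*} [DecidableEq V] (G : SimpleGraph V) {S T : Finset V}
    (hS : G.IsClique (S : Set V)) (hT : G.IsClique (T : Set V))
    [Decidable (G.IsClique (↑(S ∪ T) : Set V))] :
    ∏ a ∈ S \ T, ∏ b ∈ T \ S, adjInd G a b =
      if G.IsClique (↑(S ∪ T) : Set V) then 1 else 0 := by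
  split_ifs with h
  · refine prod_eq_one fun a ha => prod_eq_one fun b hb => ?_
    rw [Finset.mem_sdiff] at ha hb
    refine if_pos (h ?_ ?_ ?_)
    · simp [ha.1]
    · simp [hb.1]
    · rintro rfl
      exact ha.2 hb.1
  · have : ∃ a ∈ S \ T, ∃ b ∈ T \ S, ¬ G.Adj a b := by
      by_contra! hcon
      refine h fun x hx y hy hxy => ?_
      simp only [coe_union, Set.mem_union, mem_coe] at hx hy
      by_cases hxS : x ∈ S <;> by_cases hyS : y ∈ S
      · exact hS hxS hyS hxy
      · have hyT := hy.resolve_left hyS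
        by_cases hxT : x ∈ T
        · exact hT hxT hyT hxy
        · exact hcon x (mem_sdiff.mpr ⟨hxS, hxT⟩) y (mem_sdiff.mpr ⟨hyT, hyS⟩)
      · have hxT := hx.resolve_left hxS
        by_cases hyT : y ∈ T
        · exact hT hxT hyT hxy
        · exact (hcon y (mem_sdiff.mpr ⟨hyS, hyT⟩) x (mem_sdiff.mpr ⟨hxT, hxS⟩)).symm
      · exact hT (hx.resolve_left hxS) (hy.resolve_left hyS) hxy
    obtain ⟨a, ha, b, hb, hab⟩ := this
    exact prod_eq_zero ha (prod_eq_zero hb (if_neg hab))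

lemma cliqueMoment_eq {V : Type*} [DecidableEq V] (G : SimpleGraph V) {q : ℝ} (hq : q ≠ 0)
    {S T : Finset V} (hS : G.IsClique (S : Set V)) (hT : G.IsClique (T : Set V)) :
    cliqueMoment G q S T = cliqueWeight q #S * cliqueWeight q #T *
      (q⁻¹ ^ #(S ∩ T) / 2 ^ (#(S ∩ T)).choose 2 * (1 + 2 ^ (#(S \ T) * #(T \ S)) *
        crossDiff (adjInd G) halfInd (S \ T) (T \ S))) := by
  classical
  have hprod : ∏ a ∈ S \ T, ∏ b ∈ T \ S, halfInd a b = (1 / 2 : ℝ) ^ (#(S \ T) * #(T \ S)) := by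
    rw [mul_comm, pow_mul, ← prod_const]
    refine prod_congr rfl fun a ha => ?_
    rw [← prod_const]
    refine prod_congr rfl fun b hb => if_neg ?_
    rintro rfl
    exact (mem_sdiff.mp hb).2 (mem_sdiff.mp ha).1
  have hpow : (2 : ℝ) ^ (#(S \ T) * #(T \ S)) * (1 / 2 : ℝ) ^ (#(S \ T) * #(T \ S)) = 1 := by
    rw [← mul_pow]
    norm_num
  have hS' : #S = #(S \ T) + #(S ∩ T) := (card_sdiff_add_card_inter S T).symm
  have hT' : #T = #(T \ S) + #(S ∩ T) := by
    rw [inter_comm]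
    exact (card_sdiff_add_card_inter T S).symm
  have hU : #(S ∪ T) = #(S \ T) + #(T \ S) + #(S ∩ T) := by
    have := card_union_add_card_inter S T
    omega
  have hchoose := choose_two_add_add #(S \ T) #(T \ S) #(S ∩ T)
  rw [crossDiff, hprod, prod_adjInd G hS hT, mul_sub, hpow, cliqueMoment]
  by_cases hc : G.IsClique (↑(S ∪ T) : Set V)
  · simp only [if_pos hc, mul_one, add_sub_cancel, cliqueWeight]
    rw [← hU, ← hS', ← hT'] at hchoose
    have h2 : (2 : ℝ) ^ (#(S ∪ T)).choose 2 * 2 ^ (#(S ∩ T)).choose 2 =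
        2 ^ (#S).choose 2 * 2 ^ (#T).choose 2 * 2 ^ (#(S \ T) * #(T \ S)) := by
      rw [← pow_add, hchoose, pow_add, pow_add]
    have hqq : q ^ #S * q ^ #T * q⁻¹ ^ #(S ∩ T) = q ^ #(S ∪ T) := by
      rw [hU, hS', hT', inv_pow, pow_add, pow_add, pow_add, pow_add]
      field_simp
    rw [← hqq, eq_comm]
    calc _ = q ^ #S * q ^ #T * q⁻¹ ^ #(S ∩ T) *
          (2 ^ (#S).choose 2 * 2 ^ (#T).choose 2 * 2 ^ (#(S \ T) * #(T \ S))) /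
            2 ^ (#(S ∩ T)).choose 2 := by ring
      _ = _ := by
          rw [← h2]
          field_simp
  · simp only [if_neg hc]
    ring

lemma cliqueMoment_quadForm_nonneg {n : ℕ} (hn : 0 < n) (r : ℕ) (G : SimpleGraph (Fin n))
    {k N : ℝ} (hk : 1 ≤ k) (hkQ : k * 2 ^ (r + 1 + r * r) ≤ n) (hN : 0 ≤ N)
    (hB : BilinBound (fun x y => adjInd G x y - halfInd x y) N)
    (hkN : 2 ^ (r * r) * r * r * (r + 1) * N * 2 ^ r * ((r + 1) * 2 ^ r) *
      (2 * 2 ^ (r * r)) * k ^ r ≤ n) (x : Finset (Fin n) → ℝ) (hx : ∀ S, r < #S → x S = 0) :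
    0 ≤ ∑ S, ∑ T, x S * x T * cliqueMoment G (k / n) S T := by
  classical
  have : Nonempty (Fin n) := ⟨⟨0, hn⟩⟩
  have hn0 : (0 : ℝ) < n := by exact_mod_cast hn
  have hk0 : 0 < k := by linarith
  have hq : k / n ≠ 0 := by positivity
  let y : Finset (Fin n) → ℝ := fun S =>
    if G.IsClique (S : Set (Fin n)) then x S * cliqueWeight (k / n) #S else 0
  have e : ∀ S T, x S * x T * cliqueMoment G (k / n) S T =
      y S * y T * ((k / n)⁻¹ ^ #(S ∩ T) / 2 ^ (#(S ∩ T)).choose 2 *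
        (1 + 2 ^ (#(S \ T) * #(T \ S)) * crossDiff (adjInd G) halfInd (S \ T) (T \ S))) := by
    intro S T
    by_cases hS : G.IsClique (S : Set (Fin n))
    · by_cases hT : G.IsClique (T : Set (Fin n))
      · simp only [y, hS, hT, if_true]
        rw [cliqueMoment_eq G hq hS hT]
        ring
      · have : ¬ G.IsClique (↑(S ∪ T) : Set (Fin n)) := fun h =>
          hT (h.subset (by simp))
        simp only [y, cliqueMoment, if_neg hT, if_neg this, mul_zero, zero_mul]
    · have : ¬ G.IsClique (↑(S ∪ T) : Set (Fin n)) := fun h =>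
        hS (h.subset (by simp))
      simp only [y, cliqueMoment, if_neg hS, if_neg this, mul_zero, zero_mul]
  simp only [e]
  refine quadForm_nonneg (adjInd G) halfInd hN ?_ ?_ ?_ hB ?_ ?_ r
    (fun c => (k / n)⁻¹ ^ c / 2 ^ c.choose 2)
    (fun j => (fwdDiff 1)^[j] (fun c : ℕ => (k / n)⁻¹ ^ c / (2 : ℝ) ^ c.choose 2) 0)
    ?_ ?_ ?_ ?_ y ?_
  · intro x y
    unfold adjInd
    split_ifs <;> norm_num
  · intro x y
    unfold halfInd
    split_ifs <;> norm_num
  · intro x y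
    unfold adjInd halfInd
    split_ifs <;> norm_num
  · intro v
    simp [adjInd]
  · intro v
    simp [halfInd]
  · intro c
    positivity
  · intro c
    rw [Fintype.card_fin]
    refine (div_le_self (by positivity) (one_le_pow₀ (by norm_num))).trans ?_
    gcongr
    rw [inv_div]
    exact div_le_self hn0.le hk
  · intro c _
    have := shift_eq_sum_fwdDiff_iter (1 : ℕ)
      (fun c : ℕ => (k / n)⁻¹ ^ c / (2 : ℝ) ^ c.choose 2) c 0
    simpa using this
  · intro j hj
    rw [Fintype.card_fin]
    refine le_trans ?_ (le_fwdDiff_iter r ?_ hj)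
    · rw [inv_div, div_pow, div_div, le_div_iff₀ (by positivity)]
      have hkj : k ^ j ≤ k ^ r := pow_le_pow_right₀ hk hj
      calc _ = (2 ^ (r * r) * r * r * (r + 1) * N * 2 ^ r * ((r + 1) * 2 ^ r) *
            (2 * 2 ^ (r * r)) * k ^ j) / n * n ^ j := by ring
        _ ≤ 1 * n ^ j := by
            refine mul_le_mul_of_nonneg_right ?_ (by positivity)
            rw [div_le_one hn0]
            refine le_trans ?_ hkN
            gcongr
        _ = _ := one_mul _
    · rw [inv_div, le_div_iff₀ hk0, mul_comm]
      exact hkQ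
  · intro S hS
    simp [y, hx S hS]

lemma exists_SOSFeasible {n : ℕ} (hn : 0 < n) (r : ℕ) (hr : 1 ≤ r) (G : SimpleGraph (Fin n))
    {k N : ℝ} (hk : 1 ≤ k) (hkQ : k * 2 ^ (r + 1 + r * r) ≤ n) (hN : 0 ≤ N)
    (hB : BilinBound (fun x y => adjInd G x y - halfInd x y) N)
    (hkN : 2 ^ (r * r) * r * r * (r + 1) * N * 2 ^ r * ((r + 1) * 2 ^ r) *
      (2 * 2 ^ (r * r)) * k ^ r ≤ n) :
    ∃ M, SOSFeasible n r G M ∧ SOSValue n r hr M = k := by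
  classical
  have hn0 : (0 : ℝ) < n := by exact_mod_cast hn
  have hk0 : 0 < k := by linarith
  have hq0 : 0 ≤ k / n := by positivity
  have hq1 : k / n * 2 ^ r ≤ 1 := by
    rw [div_mul_eq_mul_div, div_le_one hn0]
    refine le_trans ?_ hkQ
    have : (2 : ℝ) ^ r ≤ 2 ^ (r + 1 + r * r) := pow_le_pow_right₀ (by norm_num) (by omega)
    gcongr
  refine ⟨fun S T => cliqueMoment G (k / n) S.1 T.1, ⟨?_, ?_, ?_, ?_, ?_⟩, ?_⟩
  · refine Matrix.PosSemidef.of_dotProduct_mulVec_nonneg ?_ fun v => ?_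
    · ext S T
      change star (cliqueMoment G (k / n) T.1 S.1) = cliqueMoment G (k / n) S.1 T.1
      rw [star_trivial, cliqueMoment, cliqueMoment, union_comm]
    · let x : Finset (Fin n) → ℝ := fun S => if h : #S ≤ r then v ⟨S, h⟩ else 0
      have hx : ∀ S, r < #S → x S = 0 := fun S hS => dif_neg (by omega)
      have hxv : ∀ S : {S : Finset (Fin n) // #S ≤ r}, x S.1 = v S := fun S => dif_pos S.2
      have hsum : ∀ f : Finset (Fin n) → ℝ, (∀ S, r < #S → f S = 0) →
          ∑ S, f S = ∑ S : {S : Finset (Fin n) // #S ≤ r}, f S.1 := by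
        intro f hf
        rw [← sum_subtype (univ.filter fun S : Finset (Fin n) => #S ≤ r) (by simp) f, sum_filter]
        refine sum_congr rfl fun S _ => ?_
        split_ifs with h
        · rfl
        · exact hf S (by omega)
      have h0 := cliqueMoment_quadForm_nonneg hn r G hk hkQ hN hB hkN x hx
      rw [hsum _ fun S hS => by simp [hx S hS]] at h0
      refine h0.trans_eq (sum_congr rfl fun S _ => ?_)
      change _ = v S * ∑ T : {S : Finset (Fin n) // #S ≤ r}, cliqueMoment G (k / n) S.1 T.1 * v T
      rw [hsum _ fun T hT => by simp [hx T hT], mul_sum]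
      refine sum_congr rfl fun T _ => ?_
      rw [hxv, hxv]
      ring
  · intro S₁ S₂ S₃ S₄ h
    simp only [cliqueMoment, h]
  · intro i j _ _ hij hadj
    refine if_neg fun h => hadj (h ?_ ?_ hij) <;> simp
  · intro S T
    have hcard : #(S.1 ∪ T.1) ≤ 2 * r :=
      (card_union_le _ _).trans (by have := S.2; have := T.2; omega)
    change 0 ≤ cliqueMoment G (k / n) S.1 T.1 ∧ cliqueMoment G (k / n) S.1 T.1 ≤ 1
    unfold cliqueMoment
    split_ifs
    · exact ⟨cliqueWeight_nonneg hq0 _, cliqueWeight_le_one hq0 hcard hq1⟩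
    · norm_num
  · intro _
    simp [cliqueMoment, cliqueWeight]
  · simp only [SOSValue, cliqueMoment, cliqueWeight]
    simp
    field_simp

open Classical in
/-- A graph on a linearly ordered vertex set is a choice of a Boolean for every increasing pair. -/
noncomputable def edgeBoolEquiv (V : Type*) [LinearOrder V] :
    ({p : V × V // p.1 < p.2} → Bool) ≃ SimpleGraph V where
  toFun b := SimpleGraph.fromRel fun x y => ∃ h : x < y, b ⟨(x, y), h⟩ = true
  invFun G p := decide (G.Adj p.1.1 p.1.2)
  left_inv b := by
    ext ⟨⟨x, y⟩, h⟩
    change x < y at h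
    simp [h, h.ne, h.not_gt]
  right_inv G := by
    ext x y
    rw [SimpleGraph.fromRel_adj]
    rcases lt_trichotomy x y with h | rfl | h
    · simp [h, h.ne, h.not_gt]
    · simp
    · simp [h, h.ne', h.not_gt, G.adj_comm]

lemma edgeBoolEquiv_adj {V : Type*} [LinearOrder V] (b : {p : V × V // p.1 < p.2} → Bool)
    (p : {p : V × V // p.1 < p.2}) :
    (edgeBoolEquiv V b).Adj p.1.1 p.1.2 ↔ b p = true := by
  obtain ⟨⟨x, y⟩, h⟩ := p
  change x < y at h
  simp [edgeBoolEquiv, h, h.ne, h.not_gt]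

/-- The sign attached to a Boolean. -/
def boolSign (b : Bool) : ℝ := if b then 1 else -1

lemma sum_exp_boolSign_le {P : Type*} [Fintype P] [DecidableEq P] (w : P → ℝ) :
    ∑ b : P → Bool, Real.exp (∑ p, w p * boolSign (b p)) ≤
      2 ^ Fintype.card P * Real.exp ((∑ p, w p ^ 2) / 2) := by
  calc ∑ b : P → Bool, Real.exp (∑ p, w p * boolSign (b p)) =
        ∏ p, ∑ β : Bool, Real.exp (w p * boolSign β) := by
        rw [prod_univ_sum, Fintype.piFinset_univ]
        simp only [Real.exp_sum]
    _ ≤ ∏ p, (2 * Real.exp (w p ^ 2 / 2)) := by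
        refine prod_le_prod (fun p _ => sum_nonneg fun _ _ => (Real.exp_pos _).le) fun p _ => ?_
        have := Real.cosh_le_exp_half_sq (w p)
        rw [Real.cosh_eq] at this
        simp only [Fintype.sum_bool, boolSign, if_true, Bool.false_eq_true, if_false, mul_one,
          mul_neg]
        linarith
    _ = _ := by
        rw [prod_mul_distrib, prod_const, card_univ, ← Real.exp_sum, sum_div]

open Classical in
lemma card_lt_sum_boolSign_le {P : Type*} [Fintype P] [DecidableEq P] (w : P → ℝ) {v t : ℝ}
    (hv : 0 < v) (hw : ∑ p, w p ^ 2 ≤ v) (ht : 0 ≤ t) :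
    (#{b : P → Bool | t < ∑ p, w p * boolSign (b p)} : ℝ) * Real.exp (t ^ 2 / (2 * v)) ≤
      2 ^ Fintype.card P := by
  have h1 := sum_exp_boolSign_le (fun p => t / v * w p)
  have h2 : (∑ p, (t / v * w p) ^ 2) / 2 ≤ t ^ 2 / (2 * v) := by
    simp only [mul_pow, ← mul_sum]
    calc (t / v) ^ 2 * (∑ p, w p ^ 2) / 2 ≤ (t / v) ^ 2 * v / 2 := by gcongr
      _ = _ := by field_simp
  have h3 : (#{b : P → Bool | t < ∑ p, w p * boolSign (b p)} : ℝ) * Real.exp (t ^ 2 / v) ≤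
      ∑ b : P → Bool, Real.exp (∑ p, t / v * w p * boolSign (b p)) := by
    rw [← nsmul_eq_mul, ← sum_const]
    refine (sum_le_sum fun b hb => ?_).trans
      (sum_le_sum_of_subset_of_nonneg (filter_subset _ _) fun _ _ _ => (Real.exp_pos _).le)
    rw [Real.exp_le_exp]
    simp only [mul_assoc, ← mul_sum]
    calc t ^ 2 / v = t / v * t := by ring
      _ ≤ _ := mul_le_mul_of_nonneg_left (mem_filter.mp hb).2.le (by positivity)
  have h4 : Real.exp (t ^ 2 / v) = Real.exp (t ^ 2 / (2 * v)) * Real.exp (t ^ 2 / (2 * v)) := by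
    rw [← Real.exp_add]
    congr 1
    field_simp
    norm_num
  rw [h4, ← mul_assoc] at h3
  refine le_of_mul_le_mul_right (h3.trans (h1.trans ?_)) (Real.exp_pos (t ^ 2 / (2 * v)))
  gcongr

open Classical in
lemma card_lt_abs_sum_boolSign_le {P : Type*} [Fintype P] [DecidableEq P] (w : P → ℝ) {v t : ℝ}
    (hv : 0 < v) (hw : ∑ p, w p ^ 2 ≤ v) (ht : 0 ≤ t) :
    (#{b : P → Bool | t < |∑ p, w p * boolSign (b p)|} : ℝ) * Real.exp (t ^ 2 / (2 * v)) ≤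
      2 * 2 ^ Fintype.card P := by
  have h1 := card_lt_sum_boolSign_le w hv hw ht
  have h2 := card_lt_sum_boolSign_le (fun p => -w p) hv (by simpa using hw) ht
  have h3 : #{b : P → Bool | t < |∑ p, w p * boolSign (b p)|} ≤
      #{b : P → Bool | t < ∑ p, w p * boolSign (b p)} +
        #{b : P → Bool | t < ∑ p, -w p * boolSign (b p)} := by
    refine (card_le_card fun b hb => ?_).trans (card_union_le _ _)
    simp only [neg_mul, sum_neg_distrib, mem_union, mem_filter, mem_univ, true_and] at hb ⊢
    exact lt_abs.mp hb
  have h4 : (#{b : P → Bool | t < |∑ p, w p * boolSign (b p)|} : ℝ) ≤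
      #{b : P → Bool | t < ∑ p, w p * boolSign (b p)} +
        #{b : P → Bool | t < ∑ p, -w p * boolSign (b p)} := by exact_mod_cast h3
  calc _ ≤ _ := mul_le_mul_of_nonneg_right h4 (Real.exp_pos _).le
    _ ≤ _ := by linarith

/-- The number of ways the increasing pair `p` occurs in `X ×ˢ Y`, halved. -/
noncomputable def pairWeight {V : Type*} [DecidableEq V] (X Y : Finset V) (p : V × V) : ℝ :=
  ((if p.1 ∈ X ∧ p.2 ∈ Y then 1 else 0) + if p.2 ∈ X ∧ p.1 ∈ Y then 1 else 0) / 2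

lemma sum_adjInd_sub_halfInd {V : Type*} [Fintype V] [LinearOrder V]
    (b : {p : V × V // p.1 < p.2} → Bool) (X Y : Finset V) :
    ∑ x ∈ X, ∑ y ∈ Y, (adjInd (edgeBoolEquiv V b) x y - halfInd x y) =
      ∑ p, pairWeight X Y p.1 * boolSign (b p) := by
  classical
  set d : V → V → ℝ := fun x y => adjInd (edgeBoolEquiv V b) x y - halfInd x y with hd
  have hdiag : ∀ x, d x x = 0 := fun x => by simp [hd, adjInd, halfInd]
  have hsymm : ∀ x y, d x y = d y x := by
    intro x y
    have h1 : halfInd x y = halfInd y x := by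
      by_cases h : x = y
      · simp [h]
      · simp [halfInd, h, Ne.symm h]
    exact congrArg₂ (· - ·) (if_congr (SimpleGraph.adj_comm _ x y) rfl rfl) h1
  have hpair : ∀ p : {p : V × V // p.1 < p.2}, d p.1.1 p.1.2 = boolSign (b p) / 2 := by
    intro p
    simp only [hd, adjInd, halfInd, edgeBoolEquiv_adj, p.2.ne, if_false, boolSign]
    split_ifs <;> norm_num
  have e1 : ∑ x ∈ X, ∑ y ∈ Y, d x y = ∑ p : V × V, if p.1 ∈ X ∧ p.2 ∈ Y then d p.1 p.2 else 0 := by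
    rw [← sum_product' X Y d, ← sum_filter]
    exact sum_congr (by ext; simp) fun _ _ => rfl
  have e2 : ∑ p : V × V, (if p.1 ∈ X ∧ p.2 ∈ Y then d p.1 p.2 else 0) =
      ∑ p : V × V with p.1 < p.2, (if p.1 ∈ X ∧ p.2 ∈ Y then d p.1 p.2 else 0) +
      ∑ p : V × V with p.2 < p.1, (if p.1 ∈ X ∧ p.2 ∈ Y then d p.1 p.2 else 0) := by
    rw [sum_filter, sum_filter, ← sum_add_distrib]
    refine sum_congr rfl fun p _ => ?_
    rcases lt_trichotomy p.1 p.2 with h | h | h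
    · simp [h, h.not_gt]
    · simp [h, hdiag]
    · simp [h, h.not_gt]
  have e3 : ∑ p : V × V with p.2 < p.1, (if p.1 ∈ X ∧ p.2 ∈ Y then d p.1 p.2 else 0) =
      ∑ p : V × V with p.1 < p.2, (if p.2 ∈ X ∧ p.1 ∈ Y then d p.1 p.2 else 0) := by
    refine sum_bij' (fun p _ => p.swap) (fun p _ => p.swap) ?_ ?_ ?_ ?_ ?_ <;>
      simp [hsymm]
  rw [e1, e2, e3, ← sum_add_distrib,
    sum_subtype (p := fun p : V × V => p.1 < p.2) _ (by simp)]
  refine sum_congr rfl fun p _ => ?_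
  rw [hpair, pairWeight]
  split_ifs <;> ring

lemma sum_pairWeight_sq_le {V : Type*} [Fintype V] [LinearOrder V] (X Y : Finset V) :
    ∑ p : {p : V × V // p.1 < p.2}, pairWeight X Y p.1 ^ 2 ≤ #X * #Y / 2 := by
  have e0 : ∀ p : V × V, pairWeight X Y p ^ 2 ≤
      ((if p.1 ∈ X ∧ p.2 ∈ Y then 1 else 0) + if p.2 ∈ X ∧ p.1 ∈ Y then 1 else 0) / 2 := by
    intro p
    unfold pairWeight
    split_ifs <;> norm_num
  have e1 : (#X * #Y : ℝ) = ∑ p : V × V, if p.1 ∈ X ∧ p.2 ∈ Y then 1 else 0 := by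
    rw [sum_boole, ← Nat.cast_mul, ← card_product]
    congr 2
    ext p
    simp
  have e2 : ∑ p : V × V with p.1 < p.2, (if p.2 ∈ X ∧ p.1 ∈ Y then (1 : ℝ) else 0) =
      ∑ p : V × V with p.2 < p.1, (if p.1 ∈ X ∧ p.2 ∈ Y then 1 else 0) :=
    sum_bij' (fun p _ => p.swap) (fun p _ => p.swap) (by simp) (by simp) (by simp) (by simp)
      (by simp)
  calc _ ≤ ∑ p : {p : V × V // p.1 < p.2}, ((if p.1.1 ∈ X ∧ p.1.2 ∈ Y then (1 : ℝ) else 0) +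
        if p.1.2 ∈ X ∧ p.1.1 ∈ Y then 1 else 0) / 2 := sum_le_sum fun p _ => e0 p.1
    _ = (∑ p : V × V with p.1 < p.2, (if p.1 ∈ X ∧ p.2 ∈ Y then (1 : ℝ) else 0) +
        ∑ p : V × V with p.2 < p.1, (if p.1 ∈ X ∧ p.2 ∈ Y then 1 else 0)) / 2 := by
        rw [← e2, ← sum_add_distrib, sum_div,
          sum_subtype (p := fun p : V × V => p.1 < p.2) _ (by simp)]
    _ ≤ _ := by
        rw [e1]
        refine div_le_div_of_nonneg_right ?_ (by norm_num)
        rw [sum_filter, sum_filter, ← sum_add_distrib]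
        refine sum_le_sum fun p _ => ?_
        by_cases h : p.1 < p.2
        · simp [h, h.not_gt]
        · by_cases h' : p.2 < p.1
          · simp [h, h']
          · simp only [h, h', if_false, add_zero]
            split_ifs <;> norm_num

open Classical in
lemma card_discrepancy_le (n : ℕ) :
    (#{G : SimpleGraph (Fin n) | ∃ X Y : Finset (Fin n), 2 * √n * √(#X : ℝ) * √(#Y : ℝ) <
        |∑ x ∈ X, ∑ y ∈ Y, (adjInd G x y - halfInd x y)|} : ℝ) * Real.exp (4 * n) ≤
      4 ^ n * (2 * Fintype.card (SimpleGraph (Fin n))) := by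
  have hcard : (Fintype.card (SimpleGraph (Fin n)) : ℝ) =
      2 ^ Fintype.card {p : Fin n × Fin n // p.1 < p.2} := by
    rw [← Fintype.card_congr (edgeBoolEquiv (Fin n))]
    simp
  have single : ∀ X Y : Finset (Fin n),
      (#{G : SimpleGraph (Fin n) | 2 * √n * √(#X : ℝ) * √(#Y : ℝ) <
        |∑ x ∈ X, ∑ y ∈ Y, (adjInd G x y - halfInd x y)|} : ℝ) * Real.exp (4 * n) ≤
      2 * Fintype.card (SimpleGraph (Fin n)) := by
    intro X Y
    have e : #{G : SimpleGraph (Fin n) | 2 * √n * √(#X : ℝ) * √(#Y : ℝ) <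
        |∑ x ∈ X, ∑ y ∈ Y, (adjInd G x y - halfInd x y)|} =
        #{b : {p : Fin n × Fin n // p.1 < p.2} → Bool | 2 * √n * √(#X : ℝ) * √(#Y : ℝ) <
        |∑ p, pairWeight X Y p.1 * boolSign (b p)|} := by
      refine (card_equiv (edgeBoolEquiv (Fin n)) fun b => ?_).symm
      simp only [mem_filter, mem_univ, true_and, sum_adjInd_sub_halfInd]
    rw [e, hcard]
    rcases eq_or_ne X ∅ with rfl | hX
    · simp [pairWeight]
    rcases eq_or_ne Y ∅ with rfl | hY
    · simp [pairWeight]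
    have hX' : (0 : ℝ) < #X := by exact_mod_cast card_pos.mpr (nonempty_iff_ne_empty.mpr hX)
    have hY' : (0 : ℝ) < #Y := by exact_mod_cast card_pos.mpr (nonempty_iff_ne_empty.mpr hY)
    have h := card_lt_abs_sum_boolSign_le
      (fun p : {p : Fin n × Fin n // p.1 < p.2} => pairWeight X Y p.1)
      (v := #X * #Y / 2) (t := 2 * √n * √(#X : ℝ) * √(#Y : ℝ)) (by positivity)
      (sum_pairWeight_sq_le X Y) (by positivity)
    have ht : (2 * √(n : ℝ) * √(#X : ℝ) * √(#Y : ℝ)) ^ 2 / (2 * (#X * #Y / 2)) = 4 * n := by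
      rw [mul_pow, mul_pow, mul_pow, Real.sq_sqrt (by positivity), Real.sq_sqrt (by positivity),
        Real.sq_sqrt (by positivity)]
      field_simp
      ring
    rwa [ht] at h
  have union : #{G : SimpleGraph (Fin n) | ∃ X Y : Finset (Fin n),
      2 * √n * √(#X : ℝ) * √(#Y : ℝ) <
        |∑ x ∈ X, ∑ y ∈ Y, (adjInd G x y - halfInd x y)|} ≤
      ∑ XY : Finset (Fin n) × Finset (Fin n),
        #{G : SimpleGraph (Fin n) | 2 * √n * √(#XY.1 : ℝ) * √(#XY.2 : ℝ) <
        |∑ x ∈ XY.1, ∑ y ∈ XY.2, (adjInd G x y - halfInd x y)|} := by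
    refine (card_le_card fun G hG => ?_).trans card_biUnion_le
    obtain ⟨X, Y, h⟩ := (mem_filter.mp hG).2
    exact mem_biUnion.mpr ⟨(X, Y), mem_univ _, mem_filter.mpr ⟨mem_univ _, h⟩⟩
  calc _ ≤ (∑ XY : Finset (Fin n) × Finset (Fin n),
        (#{G : SimpleGraph (Fin n) | 2 * √n * √(#XY.1 : ℝ) * √(#XY.2 : ℝ) <
        |∑ x ∈ XY.1, ∑ y ∈ XY.2, (adjInd G x y - halfInd x y)|} : ℝ)) * Real.exp (4 * n) :=
        mul_le_mul_of_nonneg_right (by exact_mod_cast union) (Real.exp_pos _).le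
    _ ≤ ∑ XY : Finset (Fin n) × Finset (Fin n), (2 * Fintype.card (SimpleGraph (Fin n)) : ℝ) := by
        rw [sum_mul]
        exact sum_le_sum fun XY _ => single XY.1 XY.2
    _ = _ := by
        rw [sum_const, card_univ, Fintype.card_prod, Fintype.card_finset, Fintype.card_fin,
          ← mul_pow, nsmul_eq_mul]
        norm_num

lemma card_lt_pairs {V : Type*} [LinearOrder V] [Fintype V] (T : Finset V) :
    #{p : {p : V × V // p.1 < p.2} | p.1.1 ∈ T ∧ p.1.2 ∈ T} = (#T).choose 2 := by
  have e1 : #{p : {p : V × V // p.1 < p.2} | p.1.1 ∈ T ∧ p.1.2 ∈ T} =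
      #{p ∈ T ×ˢ T | p.1 < p.2} :=
    card_bij (fun p _ => p.1) (by simp +contextual) (by simp) (by simp +contextual)
  have e2 : #{p ∈ T ×ˢ T | p.1 < p.2} = #{p ∈ T ×ˢ T | p.2 < p.1} :=
    card_bij (fun p _ => p.swap) (by simp +contextual) (by simp) (by simp +contextual)
  have e3 : #T.offDiag = #{p ∈ T ×ˢ T | p.1 < p.2} + #{p ∈ T ×ˢ T | p.2 < p.1} := by
    rw [← card_union_of_disjoint]
    · congr 1
      ext p
      simp only [mem_offDiag, mem_union, mem_filter, mem_product]
      have := lt_or_lt_iff_ne (a := p.1) (b := p.2)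
      tauto
    · rw [disjoint_filter]
      exact fun p _ h => h.not_gt
  rw [offDiag_card] at e3
  rw [e1, Nat.choose_two_right, Nat.mul_sub, mul_one]
  omega

open Classical in
lemma card_isClique_mul {n : ℕ} (T : Finset (Fin n)) :
    #{G : SimpleGraph (Fin n) | G.IsClique (T : Set (Fin n))} * 2 ^ (#T).choose 2 =
      Fintype.card (SimpleGraph (Fin n)) := by
  have hcard : Fintype.card (SimpleGraph (Fin n)) =
      2 ^ Fintype.card {p : Fin n × Fin n // p.1 < p.2} := by
    rw [← Fintype.card_congr (edgeBoolEquiv (Fin n))]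
    simp
  have e : #{G : SimpleGraph (Fin n) | G.IsClique (T : Set (Fin n))} =
      #(Fintype.piFinset fun p : {p : Fin n × Fin n // p.1 < p.2} =>
        if p.1.1 ∈ T ∧ p.1.2 ∈ T then {true} else (univ : Finset Bool)) := by
    refine (card_equiv (edgeBoolEquiv (Fin n)) fun b => ?_).symm
    simp only [Fintype.mem_piFinset, mem_filter, mem_univ, true_and]
    constructor
    · intro h x hx y hy hxy
      rcases hxy.lt_or_gt with hlt | hlt
      · have := h ⟨(x, y), hlt⟩
        rw [if_pos ⟨hx, hy⟩, mem_singleton] at this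
        exact (edgeBoolEquiv_adj b ⟨(x, y), hlt⟩).mpr this
      · have := h ⟨(y, x), hlt⟩
        rw [if_pos ⟨hy, hx⟩, mem_singleton] at this
        exact ((edgeBoolEquiv_adj b ⟨(y, x), hlt⟩).mpr this).symm
    · intro h p
      split_ifs with hp
      · rw [mem_singleton, ← edgeBoolEquiv_adj]
        exact h hp.1 hp.2 p.2.ne
      · exact mem_univ _
  rw [e, hcard, Fintype.card_piFinset, ← card_lt_pairs T, ← prod_const, prod_filter,
    ← prod_mul_distrib, ← card_univ, ← prod_const]
  refine prod_congr rfl fun p _ => ?_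
  split_ifs <;> simp

open Classical in
lemma card_exists_isClique_mul_le (n m : ℕ) :
    #{G : SimpleGraph (Fin n) | ∃ T : Finset (Fin n), #T = m ∧ G.IsClique (T : Set (Fin n))} *
      2 ^ m.choose 2 ≤ n ^ m * Fintype.card (SimpleGraph (Fin n)) := by
  have union : #{G : SimpleGraph (Fin n) | ∃ T : Finset (Fin n),
      #T = m ∧ G.IsClique (T : Set (Fin n))} ≤
      ∑ T ∈ powersetCard m (univ : Finset (Fin n)),
        #{G : SimpleGraph (Fin n) | G.IsClique (T : Set (Fin n))} := by
    refine (card_le_card fun G hG => ?_).trans card_biUnion_le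
    obtain ⟨T, hT, h⟩ := (mem_filter.mp hG).2
    exact mem_biUnion.mpr ⟨T, mem_powersetCard_univ.mpr hT, mem_filter.mpr ⟨mem_univ _, h⟩⟩
  calc _ ≤ (∑ T ∈ powersetCard m (univ : Finset (Fin n)),
        #{G : SimpleGraph (Fin n) | G.IsClique (T : Set (Fin n))}) * 2 ^ m.choose 2 :=
        Nat.mul_le_mul_right _ union
    _ = ∑ T ∈ powersetCard m (univ : Finset (Fin n)), Fintype.card (SimpleGraph (Fin n)) := by
        rw [sum_mul]
        refine sum_congr rfl fun T hT => ?_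
        rw [← card_isClique_mul T, mem_powersetCard_univ.mp hT]
    _ ≤ _ := by
        rw [sum_const, card_powersetCard, card_univ, Fintype.card_fin, smul_eq_mul]
        exact Nat.mul_le_mul_right _ (Nat.choose_le_pow _ _)

lemma pow_succ_le_two_pow_choose {n m : ℕ} (hn : 3 ≤ n) (h : n ^ 3 ≤ 2 ^ m) :
    n ^ (m + 1) ≤ 2 ^ m.choose 2 := by
  have hm : 5 ≤ m := by
    by_contra! hcon
    have h1 : 2 ^ m ≤ 2 ^ 4 := Nat.pow_le_pow_right (by norm_num) (by omega)
    have h2 : 3 ^ 3 ≤ n ^ 3 := Nat.pow_le_pow_left hn 3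
    omega
  have hc : m * (m + 1) ≤ m.choose 2 * 3 := by
    have : (m : ℚ) * (m + 1) ≤ m.choose 2 * 3 := by
      rw [Nat.cast_choose_two]
      have : (5 : ℚ) ≤ m := by exact_mod_cast hm
      nlinarith
    exact_mod_cast this
  have h3 : (n ^ (m + 1)) ^ 3 ≤ (2 ^ m.choose 2) ^ 3 := by
    calc (n ^ (m + 1)) ^ 3 = (n ^ 3) ^ (m + 1) := pow_right_comm _ _ _
      _ ≤ (2 ^ m) ^ (m + 1) := Nat.pow_le_pow_left h _
      _ = 2 ^ (m * (m + 1)) := (pow_mul _ _ _).symm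
      _ ≤ 2 ^ (m.choose 2 * 3) := Nat.pow_le_pow_right (by norm_num) hc
      _ = _ := pow_mul _ _ _
  exact (Nat.pow_le_pow_iff_left (by norm_num)).mp h3

open Classical in
lemma card_large_clique_mul_le {n : ℕ} (hn : 3 ≤ n) :
    #{G : SimpleGraph (Fin n) | ∃ t : Finset (Fin n), G.IsClique (t : Set (Fin n)) ∧
      3 * Real.logb 2 n < #t} * n ≤ Fintype.card (SimpleGraph (Fin n)) := by
  have hn0 : (0 : ℝ) < n := by exact_mod_cast (by omega : 0 < n)
  have hL : 0 ≤ 3 * Real.logb 2 n := by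
    have := Real.logb_nonneg (b := 2) (x := n) (by norm_num) (by exact_mod_cast (by omega : 1 ≤ n))
    linarith
  set m := ⌊3 * Real.logb 2 n⌋₊ + 1 with hm
  have hpow : n ^ 3 ≤ 2 ^ m := by
    have h1 : 3 * Real.logb 2 n ≤ m := by
      rw [hm]
      push_cast
      exact (Nat.lt_floor_add_one _).le
    have h2 : Real.logb 2 ((n : ℝ) ^ 3) ≤ m := by
      rw [Real.logb_pow]
      exact_mod_cast h1
    rw [Real.logb_le_iff_le_rpow (by norm_num) (by positivity), Real.rpow_natCast] at h2
    exact_mod_cast h2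
  have hsub : #{G : SimpleGraph (Fin n) | ∃ t : Finset (Fin n), G.IsClique (t : Set (Fin n)) ∧
      3 * Real.logb 2 n < #t} ≤ #{G : SimpleGraph (Fin n) | ∃ T : Finset (Fin n),
        #T = m ∧ G.IsClique (T : Set (Fin n))} := by
    refine card_le_card fun G hG => ?_
    obtain ⟨t, ht, hlt⟩ := (mem_filter.mp hG).2
    have hmt : m ≤ #t := (Nat.floor_lt hL).mpr hlt
    obtain ⟨T, hT, hcard⟩ := exists_subset_card_eq hmt
    exact mem_filter.mpr ⟨mem_univ _, T, hcard, ht.subset (by exact_mod_cast hT)⟩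
  have hmain := card_exists_isClique_mul_le n m
  have hpos : 0 < n ^ m := pow_pos (by omega) _
  refine (Nat.mul_le_mul_right n hsub).trans (Nat.le_of_mul_le_mul_left ?_ hpos)
  calc _ = #{G : SimpleGraph (Fin n) | ∃ T : Finset (Fin n),
        #T = m ∧ G.IsClique (T : Set (Fin n))} * n ^ (m + 1) := by ring
    _ ≤ _ := Nat.mul_le_mul_left _ (pow_succ_le_two_pow_choose hn hpow)
    _ ≤ _ := hmain

lemma const_le {r : ℕ} (hr : 1 ≤ r) :
    (2 ^ (r * r) * r * r * (r + 1) * 16 * 2 ^ r * ((r + 1) * 2 ^ r) * (2 * 2 ^ (r * r)) : ℝ) ≤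
      (2 ^ 13) ^ (r * r) := by
  have h1 : (r : ℝ) ≤ 2 ^ r := by exact_mod_cast (Nat.lt_two_pow_self (n := r)).le
  have h2 : (r + 1 : ℝ) ≤ 2 ^ r := by exact_mod_cast (Nat.lt_two_pow_self (n := r))
  calc _ ≤ (2 ^ (r * r) * 2 ^ r * 2 ^ r * 2 ^ r * 16 * 2 ^ r * (2 ^ r * 2 ^ r) *
        (2 * 2 ^ (r * r)) : ℝ) := by gcongr
    _ = 2 ^ (2 * (r * r) + 6 * r + 5) := by ring
    _ ≤ 2 ^ (13 * (r * r)) := by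
        refine pow_le_pow_right₀ (by norm_num) ?_
        nlinarith
    _ = _ := pow_mul _ _ _

/-- The value of the constructed solution. -/
noncomputable def sosSize (n r : ℕ) : ℝ :=
  (n : ℝ) ^ ((1:ℝ)/(2*r)) / ((2 ^ 13) ^ r * (Real.log n) ^ ((1:ℝ)/r))

lemma sosSize_pow {n r : ℕ} (hr : 1 ≤ r) (hlog : 1 ≤ Real.log n) :
    sosSize n r ^ r = √n / ((2 ^ 13) ^ (r * r) * Real.log n) := by
  have hr0 : (r : ℝ) ≠ 0 := by exact_mod_cast (by omega : r ≠ 0)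
  rw [sosSize, div_pow, mul_pow, ← Real.rpow_natCast, ← Real.rpow_natCast (Real.log n ^ _),
    ← Real.rpow_mul (by positivity), ← Real.rpow_mul (by linarith), ← pow_mul, Real.sqrt_eq_rpow,
    one_div_mul_cancel hr0, Real.rpow_one]
  congr 2
  field_simp

lemma exists_SOSValue_eq {r n : ℕ} (hr : 1 ≤ r) (hlog : 1 ≤ Real.log n)
    (hsqrt : (2 ^ 13) ^ (r * r) * Real.log n ≤ √n) (G : SimpleGraph (Fin n))
    (hG : ∀ X Y : Finset (Fin n), |∑ x ∈ X, ∑ y ∈ Y, (adjInd G x y - halfInd x y)| ≤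
      2 * √n * √(#X : ℝ) * √(#Y : ℝ)) :
    ∃ M, SOSFeasible n r G M ∧ SOSValue n r hr M = sosSize n r := by
  have hn : 0 < n := by
    rcases Nat.eq_zero_or_pos n with rfl | h
    · norm_num at hlog
    · exact h
  have hn1 : (1 : ℝ) ≤ n := by exact_mod_cast hn
  have hlog0 : 0 < Real.log n := by linarith
  have hk0 : 0 ≤ sosSize n r := by
    unfold sosSize
    positivity
  have hkr : 1 ≤ sosSize n r ^ r := by
    rw [sosSize_pow hr hlog, le_div_iff₀ (by positivity), one_mul]
    exact hsqrt
  have hk1 : 1 ≤ sosSize n r := (one_le_pow_iff_of_nonneg hk0 (by omega)).mp hkr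
  have hkr' : sosSize n r ^ r * (2 ^ 13) ^ (r * r) * Real.log n = √n := by
    rw [sosSize_pow hr hlog]
    field_simp
  have hB := bilinBound_of_discrepancy _ hG
  rw [Fintype.card_fin] at hB
  refine exists_SOSFeasible hn r hr G hk1 ?_ (by positivity) hB ?_
  · calc sosSize n r * 2 ^ (r + 1 + r * r) ≤ sosSize n r ^ r * (2 ^ 13) ^ (r * r) := by
          refine mul_le_mul (le_self_pow₀ hk1 (by omega)) ?_ (by positivity) (by positivity)
          rw [← pow_mul]
          refine pow_le_pow_right₀ (by norm_num) ?_
          nlinarith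
      _ ≤ sosSize n r ^ r * (2 ^ 13) ^ (r * r) * Real.log n :=
          le_mul_of_one_le_right (by positivity) hlog
      _ = √n := hkr'
      _ ≤ n := Real.sqrt_le_iff.mpr ⟨by positivity, le_self_pow₀ hn1 (by norm_num)⟩
  · calc _ ≤ 2 ^ (r * r) * r * r * (r + 1) * (4 * (2 * √n) * (Real.log n + Real.log n)) * 2 ^ r *
          ((r + 1) * 2 ^ r) * (2 * 2 ^ (r * r)) * sosSize n r ^ r := by gcongr
      _ = (2 ^ (r * r) * r * r * (r + 1) * 16 * 2 ^ r * ((r + 1) * 2 ^ r) *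
          (2 * 2 ^ (r * r))) * (√n * Real.log n * sosSize n r ^ r) := by ring
      _ ≤ (2 ^ 13) ^ (r * r) * (√n * Real.log n * sosSize n r ^ r) := by
          refine mul_le_mul_of_nonneg_right (const_le hr) (by positivity)
      _ = √n * (sosSize n r ^ r * (2 ^ 13) ^ (r * r) * Real.log n) := by ring
      _ = n := by rw [hkr', Real.mul_self_sqrt (by positivity)]

lemma le_sosSize {r n : ℕ} (hlog : 1 ≤ Real.log n) :
    (n : ℝ) ^ ((1:ℝ)/(2*r)) / ((5 * 2 ^ 13) ^ r * (Real.log n) ^ ((1:ℝ)/r)) ≤ sosSize n r := by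
  have hlog0 : 0 < Real.log n := by linarith
  unfold sosSize
  gcongr
  norm_num

lemma mul_card_le_sosSize {r n : ℕ} (hr : 1 ≤ r) (hlog : 1 ≤ Real.log n) {t : ℝ}
    (ht : t ≤ 3 * Real.logb 2 n) :
    (n : ℝ) ^ ((1:ℝ)/(2*r)) / ((5 * 2 ^ 13) ^ r * (Real.log n) ^ 2) * t ≤ sosSize n r := by
  have hlog0 : 0 < Real.log n := by linarith
  have ht' : t ≤ 5 * Real.log n := by
    refine ht.trans ?_
    have h2 := Real.log_two_gt_d9
    rw [Real.logb, mul_div_assoc', div_le_iff₀ (by linarith)]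
    nlinarith
  have h5 : (5 : ℝ) ≤ 5 ^ r := le_self_pow₀ (by norm_num) (by omega)
  have hroot : (Real.log n) ^ ((1:ℝ)/r) ≤ Real.log n := by
    calc (Real.log n) ^ ((1:ℝ)/r) ≤ (Real.log n) ^ (1:ℝ) := by
          refine Real.rpow_le_rpow_of_exponent_le hlog ?_
          rw [div_le_one (by exact_mod_cast hr)]
          exact_mod_cast hr
      _ = _ := Real.rpow_one _
  calc _ ≤ (n : ℝ) ^ ((1:ℝ)/(2*r)) / ((5 * 2 ^ 13) ^ r * (Real.log n) ^ 2) *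
        (5 ^ r * Real.log n) := by
        refine mul_le_mul_of_nonneg_left (ht'.trans ?_) (by positivity)
        gcongr
    _ = (n : ℝ) ^ ((1:ℝ)/(2*r)) / ((2 ^ 13) ^ r * Real.log n) := by
        rw [mul_pow]
        field_simp
    _ ≤ _ := by
        unfold sosSize
        gcongr

lemma eventually_log_le_sqrt (K : ℝ) :
    ∀ᶠ n : ℕ in atTop, K * Real.log n ≤ √(n : ℝ) := by
  have h := (isLittleO_log_rpow_atTop (r := 1 / 2) (by norm_num)).const_mul_left K
  have h1 := (h.comp_tendsto tendsto_natCast_atTop_atTop).bound (c := 1) one_pos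
  filter_upwards [h1] with n hn
  rw [Real.sqrt_eq_rpow]
  simp only [Function.comp_apply, one_mul, Real.norm_eq_abs] at hn
  rw [abs_of_nonneg (by positivity : (0 : ℝ) ≤ (n : ℝ) ^ (1 / 2 : ℝ))] at hn
  exact (le_abs_self _).trans hn

/-- If all objects outside two small exceptional sets have property `p`, then most do. -/
lemma one_sub_le_natCard_div {α : Type*} [Fintype α] [Nonempty α] (p b₁ b₂ : α → Prop)
    [DecidablePred b₁] [DecidablePred b₂] (h : ∀ a, ¬ b₁ a → ¬ b₂ a → p a) {ε₁ ε₂ : ℝ}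
    (h₁ : (#{a | b₁ a} : ℝ) ≤ ε₁ * Fintype.card α) (h₂ : (#{a | b₂ a} : ℝ) ≤ ε₂ * Fintype.card α) :
    1 - (ε₁ + ε₂) ≤ (Nat.card {a // p a} : ℝ) / Nat.card α := by
  classical
  have hpos : (0 : ℝ) < Fintype.card α := by exact_mod_cast Fintype.card_pos
  rw [Nat.card_eq_fintype_card, Nat.card_eq_fintype_card, Fintype.card_subtype,
    le_div_iff₀ hpos]
  have hcard : Fintype.card α ≤ #{a | p a} + (#{a | b₁ a} + #{a | b₂ a}) := by
    rw [← card_univ]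
    refine (card_le_card fun a _ => ?_).trans
      ((card_union_le _ _).trans (Nat.add_le_add_left (card_union_le _ _) _))
    simp only [mem_union, mem_filter, mem_univ, true_and]
    by_contra! hcon
    exact hcon.1 (h a hcon.2.1 hcon.2.2)
  have hcard' : (Fintype.card α : ℝ) ≤ #{a | p a} + (#{a | b₁ a} + #{a | b₂ a}) := by
    exact_mod_cast hcard
  linarith

/-- There is an absolute constant `C > 0` such that for every fixed `r ≥ 1`,
with probability tending to `1` as `n → ∞` over `G ← G(n,1/2)` (uniform over all graphs
on `[n]`), simultaneously: (a) there is a feasible solution of the `r`-round SOS relaxation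
of maximum clique on `G` of value at least `n^{1/(2r)}/(C^r (log n)^{1/r})`, (b) every
clique of `G` has size at most `3 log₂ n`, and consequently (c) the integrality gap is at
least `n^{1/(2r)}/(C^r (log n)²)`: for every clique `t` there is a feasible solution of
value at least `n^{1/(2r)}/(C^r (log n)²) · |t|`. -/
theorem sos_clique_integrality_gap :
    ∃ C : ℝ, 0 < C ∧ ∀ r : ℕ, ∀ hr : 1 ≤ r,
      Tendsto (fun n : ℕ =>
        (Nat.card {G : SimpleGraph (Fin n) //
          (∃ M, SOSFeasible n r G M ∧
              (n : ℝ) ^ ((1:ℝ)/(2*r)) / (C ^ r * (Real.log n) ^ ((1:ℝ)/r))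
                ≤ SOSValue n r hr M) ∧
          (∀ t : Finset (Fin n), G.IsClique (t : Set (Fin n)) →
              (t.card : ℝ) ≤ 3 * Real.logb 2 n) ∧
          (∀ t : Finset (Fin n), G.IsClique (t : Set (Fin n)) →
              ∃ M, SOSFeasible n r G M ∧
                ((n : ℝ) ^ ((1:ℝ)/(2*r)) / (C ^ r * (Real.log n) ^ 2)) * t.card
                  ≤ SOSValue n r hr M)} : ℝ)
          / (Nat.card (SimpleGraph (Fin n)) : ℝ))
        atTop (nhds 1) := by
  classical
  refine ⟨5 * 2 ^ 13, by norm_num, fun r hr => ?_⟩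
  have hlim : Tendsto (fun n : ℕ => 1 - (2 * (4 / 5 : ℝ) ^ n + 1 / (n : ℝ))) atTop (nhds 1) := by
    have h1 := (tendsto_pow_atTop_nhds_zero_of_lt_one (r := (4 / 5 : ℝ)) (by norm_num)
      (by norm_num)).const_mul 2
    simpa using (h1.add tendsto_one_div_atTop_nhds_zero_nat).const_sub 1
  refine tendsto_of_tendsto_of_tendsto_of_le_of_le' hlim tendsto_const_nhds ?_ ?_
  · have hlog1 : ∀ᶠ n : ℕ in atTop, 1 ≤ Real.log n :=
      (Real.tendsto_log_atTop.comp tendsto_natCast_atTop_atTop).eventually_ge_atTop 1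
    filter_upwards [hlog1, eventually_log_le_sqrt ((2 ^ 13) ^ (r * r)), eventually_ge_atTop 3]
      with n hlog hsqrt hn
    refine one_sub_le_natCard_div _
      (fun G : SimpleGraph (Fin n) => ∃ X Y : Finset (Fin n), 2 * √n * √(#X : ℝ) * √(#Y : ℝ) <
        |∑ x ∈ X, ∑ y ∈ Y, (adjInd G x y - halfInd x y)|)
      (fun G : SimpleGraph (Fin n) => ∃ t : Finset (Fin n), G.IsClique (t : Set (Fin n)) ∧
        3 * Real.logb 2 n < #t) ?_ ?_ ?_
    · intro G hG₁ hG₂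
      push Not at hG₁ hG₂
      obtain ⟨M, hM, hval⟩ := exists_SOSValue_eq hr hlog hsqrt G hG₁
      refine ⟨⟨M, hM, ?_⟩, hG₂, fun t ht => ⟨M, hM, ?_⟩⟩
      · rw [hval]
        exact le_sosSize hlog
      · rw [hval]
        exact mul_card_le_sosSize hr hlog (hG₂ t ht)
    · have h5 : (5 : ℝ) ^ n ≤ Real.exp (4 * n) := by
        rw [mul_comm, Real.exp_nat_mul]
        gcongr
        linarith [Real.add_one_le_exp (4 : ℝ)]
      have h := card_discrepancy_le n
      rw [div_pow, mul_div_assoc', div_mul_eq_mul_div, le_div_iff₀ (by positivity)]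
      calc _ ≤ _ := mul_le_mul_of_nonneg_left h5 (by positivity)
        _ ≤ _ := h
        _ = _ := by ring
    · have hn0 : (0 : ℝ) < n := by exact_mod_cast (by omega : 0 < n)
      rw [one_div_mul_eq_div, le_div_iff₀ hn0]
      exact_mod_cast card_large_clique_mul_le hn
  · refine Eventually.of_forall fun n => div_le_one_of_le₀ ?_ (by positivity)
    exact_mod_cast Finite.card_subtype_le _
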